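/- arXiv:2205.02527 — 8 statements merged into one kernel-verified Lean document; each statement's English description precedes it below -/
import Mathlib

section
/- Let N be a natural number and for each 0 ≤ k ≤ 2N−1 let p_k ∈ ℝ[x] be a monic polynomial of degree k, with formal derivative p_k'. For all x_1, …, x_N ∈ ℝ, the fourth power of the Vandermonde determinant satisfies Δ_N(X)^4 = (−1)^{N(N+1)/2} · det M, where M is the 2N×2N matrix whose first N rows are M_{i,j} = p_{2N−j}(x_i) (i ∈ [N], j ∈ [2N]) and whose last N rows are M_{N+i,j} = p_{2N−j}'(x_i) (i ∈ [N], j ∈ [2N]). -/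
open Finset Matrix Polynomial Filter Topology

theorem prod_prod_eq_prod_diag_mul_prod_Ioi {R : Type*} [CommMonoid R] {n : ℕ}
    (g : Fin n → Fin n → R) :
    ∏ i, ∏ j, g i j = (∏ i, g i i) * ∏ i, ∏ j ∈ Ioi i, g i j * g j i := by
  have h := Finset.prod_prod_Ioi_mul_eq_prod_prod_off_diag (fun i j => g j i)
  rw [h, ← Finset.prod_mul_distrib]
  refine Finset.prod_congr rfl fun i _ => ?_
  rw [← Finset.prod_mul_prod_compl {i} (g i), Finset.prod_singleton]

theorem prod_Ioi_append_eq {R : Type*} [CommRing R] {n : ℕ} (a b : Fin n → R) :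
    ∏ i, ∏ j ∈ Ioi i, (Fin.append a b i - Fin.append a b j) =
      (∏ i, ∏ j ∈ Ioi i, (a i - a j)) * (∏ i, ∏ j, (a i - b j)) *
        ∏ i, ∏ j ∈ Ioi i, (b i - b j) := by
  have key : ∀ {m : ℕ} (f : Fin m → Fin m → R), ∏ i, ∏ j ∈ Ioi i, f i j =
      ∏ i, ∏ j, if i < j then f i j else 1 := by
    intro m f
    refine Finset.prod_congr rfl fun i _ => ?_
    rw [← Finset.prod_filter]
    congr 1
    ext j
    simp
  simp only [key, Fin.prod_univ_add, Fin.append_left, Fin.append_right, Finset.prod_mul_distrib]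
  have h1 : ∀ i j : Fin n, Fin.castAdd n i < Fin.natAdd n j := fun i j => by
    rw [Fin.lt_def, Fin.val_castAdd, Fin.val_natAdd]; omega
  have h2 : ∀ i j : Fin n, ¬ Fin.natAdd n j < Fin.castAdd n i := fun i j => (h1 i j).not_gt
  have h3 : ∀ i j : Fin n, Fin.castAdd n i < Fin.castAdd n j ↔ i < j := fun _ _ => Iff.rfl
  simp [h1, h2, h3, -Fin.natAdd_eq_addNat, mul_assoc]

theorem det_eval_monic_rev {R : Type*} [CommRing R] {n : ℕ} (v : Fin n → R) (q : Fin n → R[X])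
    (hdeg : ∀ j, (q j).natDegree = (j.rev : ℕ)) (hmonic : ∀ j, (q j).Monic) :
    (Matrix.of fun i j => (q j).eval (v i)).det = ∏ i, ∏ j ∈ Ioi i, (v i - v j) := by
  have h := Matrix.det_eval_matrixOfPolynomials_eq_det_vandermonde v (fun j => q j.rev)
    (fun j => by simp [hdeg]) (fun j => hmonic _)
  have h1 := Matrix.det_permute' Fin.revPerm (Matrix.of fun i j => (q j.rev).eval (v i))
  have h2 := Matrix.det_permute' Fin.revPerm (Matrix.vandermonde v)
  rw [h, ← h1] at h2
  have h3 := Matrix.det_projVandermonde (fun _ => (1 : R)) v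
  simp only [one_mul] at h3
  rw [← h3]
  convert h2.symm using 2
  · ext i j
    simp
  · ext i j
    simp [Matrix.projVandermonde_apply, Matrix.vandermonde_apply]

theorem prod_Ioi_neg_one (R : Type*) [CommRing R] (n : ℕ) :
    (-1 : R) ^ n * ∏ i : Fin n, ∏ _j ∈ Ioi i, (-1 : R) = (-1) ^ (n * (n + 1) / 2) := by
  have : ∀ n : ℕ, n * (n + 1) / 2 = ∑ i ∈ range (n + 1), i := fun n => by
    rw [Finset.sum_range_id, mul_comm]; simp
  rw [this]
  simp only [Finset.prod_const, Fin.card_Ioi]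
  rw [Finset.prod_pow_eq_pow_sum, Fin.sum_univ_eq_sum_range (fun i => n - 1 - i) n,
    Finset.sum_range_reflect (fun i => i) n, Finset.sum_range_succ, pow_add, mul_comm]

theorem det_append_difference_quotient {n : ℕ} (x : Fin n → ℝ) (q : Fin (n + n) → ℝ[X])
    (h : ℝ) :
    (Matrix.of fun i j => (Fin.append (fun i => (q j).eval (x i))
      (fun i => h⁻¹ * ((q j).eval (x i + h) - (q j).eval (x i))) i)).det =
    (h⁻¹) ^ n * (Matrix.of fun i j => (q j).eval (Fin.append x (fun i => x i + h) i)).det := by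
  let e : Fin n ⊕ Fin n ≃ Fin (n + n) := finSumFinEquiv
  rw [← Matrix.det_submatrix_equiv_self e, ← Matrix.det_submatrix_equiv_self e (Matrix.of _)]
  have hA : (Matrix.fromBlocks (1 : Matrix (Fin n) (Fin n) ℝ) 0 (-h⁻¹ • (1 : Matrix (Fin n) (Fin n) ℝ))
      (h⁻¹ • 1)).det =
      (h⁻¹) ^ n := by
    rw [Matrix.det_fromBlocks_zero₁₂]
    simp
  rw [← hA, ← Matrix.det_mul]
  congr 1
  ext i j
  rcases i with i | i <;>
    simp [e, Matrix.mul_apply, Matrix.one_apply, -Fin.natAdd_eq_addNat]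
  ring

theorem det_confluent_rev {n : ℕ} (x : Fin n → ℝ) (q : Fin (n + n) → ℝ[X])
    (hdeg : ∀ j, (q j).natDegree = (j.rev : ℕ)) (hmonic : ∀ j, (q j).Monic) :
    (Matrix.of fun i j => Fin.append (fun i => (q j).eval (x i))
      (fun i => (derivative (q j)).eval (x i)) i).det =
    (-1) ^ (n * (n + 1) / 2) * (∏ i, ∏ j ∈ Ioi i, (x i - x j)) ^ 4 := by
  have hL : Tendsto (fun h : ℝ => (Matrix.of fun i j => (Fin.append (fun i => (q j).eval (x i))
      (fun i => h⁻¹ * ((q j).eval (x i + h) - (q j).eval (x i))) i)).det) (𝓝[≠] 0)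
      (𝓝 (Matrix.of fun i j => Fin.append (fun i => (q j).eval (x i))
      (fun i => (derivative (q j)).eval (x i)) i).det) := by
    refine ((continuous_id.matrix_det).tendsto _).comp ?_
    refine tendsto_pi_nhds.2 fun i => tendsto_pi_nhds.2 fun j => ?_
    refine Fin.addCases (fun i => ?_) (fun i => ?_) i
    · simp
    · simpa [-Fin.natAdd_eq_addNat] using ((q j).hasDerivAt (x i)).tendsto_slope_zero
  have hR : Tendsto (fun h : ℝ => (∏ i, ∏ j ∈ Ioi i, (x i - x j)) ^ 2 * ((-1) ^ n *
      ∏ i, ∏ j ∈ Ioi i, (x i - (x j + h)) * (x j - (x i + h)))) (𝓝[≠] 0)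
      (𝓝 ((∏ i, ∏ j ∈ Ioi i, (x i - x j)) ^ 2 * ((-1) ^ n *
      ∏ i, ∏ j ∈ Ioi i, (x i - (x j + 0)) * (x j - (x i + 0))))) :=
    (Continuous.tendsto (by fun_prop) 0).mono_left nhdsWithin_le_nhds
  refine (tendsto_nhds_unique_of_eventuallyEq hL hR ?_).trans ?_
  · filter_upwards [self_mem_nhdsWithin] with h (hh : h ≠ 0)
    rw [det_append_difference_quotient, det_eval_monic_rev _ q hdeg hmonic, prod_Ioi_append_eq,
      prod_prod_eq_prod_diag_mul_prod_Ioi]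
    have : ∏ i, (x i - (x i + h)) = (-1) ^ n * h ^ n := by
      simp [← mul_pow]
    simp only [this, add_sub_add_right_eq_sub]
    have h1 : h⁻¹ ^ n * h ^ n = 1 := by rw [← mul_pow, inv_mul_cancel₀ hh, one_pow]
    linear_combination ((∏ i, ∏ j ∈ Ioi i, (x i - x j)) ^ 2 * ((-1) ^ n *
      ∏ i, ∏ j ∈ Ioi i, (x i - (x j + h)) * (x j - (x i + h)))) * h1
  · have : ∏ i, ∏ j ∈ Ioi i, (x i - (x j + 0)) * (x j - (x i + 0)) =
        (∏ i : Fin n, ∏ _j ∈ Ioi i, (-1 : ℝ)) * (∏ i, ∏ j ∈ Ioi i, (x i - x j)) ^ 2 := by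
      simp only [← Finset.prod_pow, ← Finset.prod_mul_distrib]
      refine Finset.prod_congr rfl fun i _ => Finset.prod_congr rfl fun j _ => ?_
      ring
    rw [this, ← prod_Ioi_neg_one]
    ring

/-- **Fourth power of the Vandermonde determinant.**
For monic polynomials `p k` of degree `k` (for `k < 2N`),
`Δ_N(X)^4 = (-1)^{N(N+1)/2} det M` where the first `N` rows of `M` are
`p_{2N-j}(x_i)` and the last `N` rows are `p_{2N-j}'(x_i)`. -/
theorem stmt_1 (N : ℕ) (p : ℕ → Polynomial ℝ)
    (hmonic : ∀ k < 2 * N, (p k).Monic) (hdeg : ∀ k < 2 * N, (p k).natDegree = k)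
    (x : Fin N → ℝ) :
    (∏ i : Fin N, ∏ j ∈ Finset.Ioi i, (x i - x j)) ^ 4
      = (-1 : ℝ) ^ (N * (N + 1) / 2) *
        Matrix.det (Matrix.of fun i j : Fin (2 * N) =>
          if h : (i : ℕ) < N then
            (p (2 * N - 1 - (j : ℕ))).eval (x ⟨i, h⟩)
          else
            (Polynomial.derivative (p (2 * N - 1 - (j : ℕ)))).eval
              (x ⟨(i : ℕ) - N, by have := i.isLt; omega⟩)) := by
  have h := det_confluent_rev x (fun j => p (j.rev : ℕ))
    (fun j => hdeg _ (by omega)) (fun j => hmonic _ (by omega))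
  rw [← Matrix.det_submatrix_equiv_self (finCongr (two_mul N).symm)]
  have hsq : ((-1 : ℝ) ^ (N * (N + 1) / 2)) * (-1) ^ (N * (N + 1) / 2) = 1 := by
    rw [← mul_pow]; simp
  refine Eq.trans ?_ (congrArg (_ * ·) (h.symm.trans ?_))
  · linear_combination -(∏ i, ∏ j ∈ Ioi i, (x i - x j)) ^ 4 * hsq
  · congr 1
    ext i j
    have hj : N + N - ((j : ℕ) + 1) = 2 * N - 1 - j := by omega
    refine Fin.addCases (fun i => ?_) (fun i => ?_) i <;> simp [hj, -Fin.natAdd_eq_addNat]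
end

section
/- Let N ≥ M be natural numbers, x_1, …, x_N pairwise distinct reals, y_1, …, y_M pairwise distinct reals, with x_i ≠ y_j for all i, j. Let C be the N×N matrix with entries C_{i,j} = 1/(x_i − y_j) for j ∈ [M] and C_{i,M+k} = x_i^{k−1} for k ∈ [N−M]. Then det C = (−1)^{N(N−1)/2} · Δ_N(X) Δ_M(Y) / ∏_{i ∈ [N], j ∈ [M]} (x_i − y_j). -/
open Polynomial Matrix

/-- Evaluating polynomials of degree less than `n` at `n` points factors through the
Vandermonde matrix. -/
theorem Matrix.of_eval_eq_vandermonde_mul {R : Type*} [CommRing R] {n : ℕ} (v : Fin n → R)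
    {ι : Type*} (p : ι → R[X]) (hp : ∀ j, (p j).natDegree < n) :
    of (fun i j => (p j).eval (v i)) =
      vandermonde v * of (fun (k : Fin n) j => (p j).coeff k) := by
  ext i j
  simp only [of_apply, mul_apply, vandermonde_apply]
  rw [eval_eq_sum_range' (hp j), ← Fin.sum_univ_eq_sum_range (fun k => (p j).coeff k * v i ^ k)]
  exact Finset.sum_congr rfl fun k _ => mul_comm _ _

/-- Reversing every difference in a Vandermonde product costs the sign of the longest
permutation. -/
theorem prod_Ioi_sub_comm {R : Type*} [CommRing R] {n : ℕ} (v : Fin n → R) :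
    ∏ i : Fin n, ∏ j ∈ Finset.Ioi i, (v j - v i) =
      (-1) ^ (n * (n - 1) / 2) * ∏ i : Fin n, ∏ j ∈ Finset.Ioi i, (v i - v j) := by
  have hsum : ∑ i : Fin n, (n - 1 - (i : ℕ)) = n * (n - 1) / 2 := by
    rw [Fin.sum_univ_eq_sum_range (fun i => n - 1 - i), Finset.sum_range_reflect (fun i => i),
      Finset.sum_range_id]
  rw [← hsum, ← Finset.prod_pow_eq_pow_sum, ← Finset.prod_mul_distrib]
  refine Finset.prod_congr rfl fun i _ => ?_
  rw [← Fin.card_Ioi, ← Finset.prod_const, ← Finset.prod_mul_distrib]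
  exact Finset.prod_congr rfl fun j _ => by ring

/-- The coefficient matrix of the unnormalised Lagrange basis polynomials at distinct nodes
has the Vandermonde product as its determinant. -/
theorem det_coeff_prod_X_sub_C {K : Type*} [Field K] {m : ℕ} {y : Fin m → K}
    (hy : Function.Injective y) :
    (of fun k j : Fin m => (∏ l ∈ {j}ᶜ, (X - C (y l))).coeff k).det =
      ∏ i : Fin m, ∏ j ∈ Finset.Ioi i, (y i - y j) := by
  have hdeg (j : Fin m) : (∏ l ∈ {j}ᶜ, (X - C (y l))).natDegree < m := by
    rw [natDegree_finsetProd_X_sub_C_eq_card, Finset.card_compl, Finset.card_singleton,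
      Fintype.card_fin]
    have := j.pos
    omega
  have hdiag : of (fun i j : Fin m => (∏ l ∈ {j}ᶜ, (X - C (y l))).eval (y i)) =
      diagonal fun j => ∏ l ∈ {j}ᶜ, (y j - y l) := by
    ext i j
    simp only [of_apply, eval_prod, eval_sub, eval_X, eval_C, diagonal_apply]
    split_ifs with h
    · rw [h]
    · exact Finset.prod_eq_zero (i := i) (by simpa using h) (sub_self _)
  have key := congrArg det (of_eval_eq_vandermonde_mul y _ hdeg)
  rw [hdiag, det_diagonal, det_mul,
    ← Finset.prod_prod_Ioi_mul_eq_prod_prod_off_diag (fun l j => y j - y l)] at key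
  simp only [Finset.prod_mul_distrib] at key
  refine mul_left_cancel₀ (det_vandermonde_ne_zero_iff.mpr hy) (key.symm.trans ?_)
  rw [det_vandermonde, mul_comm]

/-- The coefficient matrix of the polynomials obtained by clearing denominators in the
columns of the bordered Cauchy matrix. -/
theorem det_coeff_borderedCauchy {K : Type*} [Field K] {m : ℕ} (k : ℕ) {y : Fin m → K}
    (hy : Function.Injective y) (p : Fin (m + k) → K[X])
    (hl : ∀ j, p (Fin.castAdd k j) = ∏ l ∈ {j}ᶜ, (X - C (y l)))
    (hr : ∀ j, p (Fin.natAdd m j) = X ^ (j : ℕ) * ∏ l, (X - C (y l))) :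
    (of fun i j : Fin (m + k) => (p j).coeff i).det =
      ∏ i : Fin m, ∏ j ∈ Finset.Ioi i, (y i - y j) := by
  have hmonic : (∏ l, (X - C (y l))).Monic := monic_prod_X_sub_C y _
  have hdeg : (∏ l, (X - C (y l))).natDegree = m := by
    simp [natDegree_finsetProd_X_sub_C_eq_card]
  have hnat (j : Fin k) : (X ^ (j : ℕ) * ∏ l, (X - C (y l))).natDegree = j + m := by
    rw [(monic_X_pow _).natDegree_mul hmonic, natDegree_X_pow, hdeg]
  rw [← det_submatrix_equiv_self finSumFinEquiv, ← fromBlocks_toBlocks (submatrix _ _ _)]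
  have h21 : (submatrix (of fun i j : Fin (m + k) => (p j).coeff i)
      finSumFinEquiv finSumFinEquiv).toBlocks₂₁ = 0 := by
    ext i j
    simp only [toBlocks₂₁, submatrix_apply, of_apply, finSumFinEquiv_apply_left,
      finSumFinEquiv_apply_right, hl, Matrix.zero_apply]
    apply coeff_eq_zero_of_natDegree_lt
    rw [natDegree_finsetProd_X_sub_C_eq_card, Finset.card_compl, Finset.card_singleton,
      Fintype.card_fin, Fin.val_natAdd]
    have := j.pos
    omega
  have h22 : (submatrix (of fun i j : Fin (m + k) => (p j).coeff i)
      finSumFinEquiv finSumFinEquiv).toBlocks₂₂.det = 1 := by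
    rw [det_of_isUpperTriangular]
    · refine Finset.prod_eq_one fun i _ => ?_
      simp only [toBlocks₂₂, submatrix_apply, of_apply, finSumFinEquiv_apply_right, hr,
        Fin.val_natAdd]
      rw [add_comm m, ← hnat i]
      exact (monic_X_pow _).mul hmonic
    · intro i j hij
      simp only [toBlocks₂₂, submatrix_apply, of_apply, finSumFinEquiv_apply_right, hr,
        Fin.val_natAdd]
      apply coeff_eq_zero_of_natDegree_lt
      rw [hnat]
      have : (j : ℕ) < i := hij
      omega
  rw [h21, det_fromBlocks_zero₂₁, h22, mul_one, ← det_coeff_prod_X_sub_C hy]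
  congr 1
  ext i j
  simp [toBlocks₁₁, hl]

/-- **Bordered Cauchy determinant formula.**
For `N ≥ M`, the determinant of the `N × N` matrix whose first `M` columns are
`1/(x_i - y_j)` and remaining `N - M` columns are `x_i^{k-1}` equals
`(-1)^{N(N-1)/2} Δ_N(X) Δ_M(Y) / ∏_{i,j} (x_i - y_j)`. -/
theorem stmt_3 (N M : ℕ) (hNM : M ≤ N) (x : Fin N → ℝ) (y : Fin M → ℝ)
    (hx : Function.Injective x) (hy : Function.Injective y)
    (hxy : ∀ i j, x i ≠ y j) :
    Matrix.det (Matrix.of fun i j : Fin N =>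
        if h : (j : ℕ) < M then (x i - y ⟨j, h⟩)⁻¹ else x i ^ ((j : ℕ) - M))
      = (-1 : ℝ) ^ (N * (N - 1) / 2) *
        ((∏ i : Fin N, ∏ j ∈ Finset.Ioi i, (x i - x j)) *
          (∏ i : Fin M, ∏ j ∈ Finset.Ioi i, (y i - y j)) /
          ∏ i : Fin N, ∏ j : Fin M, (x i - y j)) := by
  obtain ⟨k, rfl⟩ := Nat.exists_eq_add_of_le hNM
  have hne : ∏ i, ∏ j, (x i - y j) ≠ 0 :=
    Finset.prod_ne_zero_iff.mpr fun i _ =>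
      Finset.prod_ne_zero_iff.mpr fun j _ => sub_ne_zero.mpr (hxy i j)
  let p : Fin (M + k) → ℝ[X] :=
    Fin.addCases (fun j => ∏ l ∈ {j}ᶜ, (X - C (y l))) fun j => X ^ (j : ℕ) * ∏ l, (X - C (y l))
  have hl (j : Fin M) : p (Fin.castAdd k j) = ∏ l ∈ {j}ᶜ, (X - C (y l)) := Fin.addCases_left _
  have hr (j : Fin k) : p (Fin.natAdd M j) = X ^ (j : ℕ) * ∏ l, (X - C (y l)) :=
    Fin.addCases_right _
  have hdeg (j : Fin (M + k)) : (p j).natDegree < M + k := by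
    refine Fin.addCases (fun j => ?_) (fun j => ?_) j
    · rw [hl, natDegree_finsetProd_X_sub_C_eq_card, Finset.card_compl, Finset.card_singleton,
        Fintype.card_fin]
      have := j.pos
      omega
    · rw [hr, (monic_X_pow _).natDegree_mul (monic_prod_X_sub_C y _), natDegree_X_pow,
        natDegree_finsetProd_X_sub_C_eq_card, Finset.card_univ, Fintype.card_fin]
      omega
  have hclear := Matrix.det_mul_column (fun i => ∏ l, (x i - y l))
    (Matrix.of fun i j : Fin (M + k) =>
      if h : (j : ℕ) < M then (x i - y ⟨j, h⟩)⁻¹ else x i ^ ((j : ℕ) - M))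
  have heval : (Matrix.of fun i j : Fin (M + k) => (∏ l, (x i - y l)) *
      (Matrix.of fun i j : Fin (M + k) =>
        if h : (j : ℕ) < M then (x i - y ⟨j, h⟩)⁻¹ else x i ^ ((j : ℕ) - M)) i j) =
      Matrix.of fun i j => (p j).eval (x i) := by
    ext i j
    simp only [Matrix.of_apply]
    refine Fin.addCases (fun j => ?_) (fun j => ?_) j
    · rw [hl, ← Finset.prod_mul_prod_compl {j}]
      have := sub_ne_zero.mpr (hxy i j)
      simp [eval_prod]
      field_simp
    · simp [hr, eval_prod, mul_comm]
  rw [heval, Matrix.of_eval_eq_vandermonde_mul x p hdeg, Matrix.det_mul, Matrix.det_vandermonde,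
    prod_Ioi_sub_comm, det_coeff_borderedCauchy k hy p hl hr] at hclear
  rw [← mul_div_assoc, eq_div_iff hne, mul_comm, ← hclear, mul_assoc]
end

section
/- Let n, m be even natural numbers, A an invertible skew-symmetric real n×n matrix, Ã a skew-symmetric real m×m matrix, and B a real n×m matrix. Then the Pfaffian of the (n+m)×(n+m) block skew-symmetric matrix [[A, B], [−Bᵀ, Ã]] factorizes as Pf [[A, B], [−Bᵀ, Ã]] = Pf A · Pf( Ã + Bᵀ A^{−1} B ). (Note Ã + Bᵀ A^{−1} B is skew-symmetric since A^{−1} is skew-symmetric.) -/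
open Matrix

/-- The Pfaffian of an `m × m` real matrix (intended for skew-symmetric matrices
with `m` even): `Pf M = (1/(2^n n!)) Σ_{σ} sgn(σ) ∏_{i=1}^{n} M_{σ(2i-1), σ(2i)}`
with `n = m / 2`. -/
noncomputable def pfaffian {m : ℕ} (M : Matrix (Fin m) (Fin m) ℝ) : ℝ :=
  ((2 : ℝ) ^ (m / 2) * (m / 2).factorial)⁻¹ *
    ∑ σ : Equiv.Perm (Fin m), ((Equiv.Perm.sign σ : ℤ) : ℝ) *
      ∏ i : Fin (m / 2),
        M (σ ⟨2 * (i : ℕ), by have := i.isLt; omega⟩)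
          (σ ⟨2 * (i : ℕ) + 1, by have := i.isLt; omega⟩)

/-- The alternating sum over permutations which defines the Pfaffian, with a separate matrix for
each pair of positions; the pairs of positions are labelled by `e : κ × Fin 2 ≃ ι`. -/
def pfaffianSum {κ ι : Type*} [Fintype κ] [Fintype ι] [DecidableEq ι] (e : κ × Fin 2 ≃ ι)
    (M : κ → Matrix ι ι ℝ) : ℝ :=
  ∑ σ : Equiv.Perm ι, ((Equiv.Perm.sign σ : ℤ) : ℝ) * ∏ k, M k (σ (e (k, 0))) (σ (e (k, 1)))

/-- If some term of the alternating sum is nonzero, its permutation sends a pair of positions to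
the left summand exactly if the pair is in `S`. -/
lemma isLeft_of_prod_ne_zero {κ ι₁ ι₂ : Type*} [Fintype κ] [DecidableEq κ]
    (e : κ × Fin 2 ≃ ι₁ ⊕ ι₂) (A : Matrix ι₁ ι₁ ℝ)
    (C : Matrix ι₂ ι₂ ℝ) (S : Finset κ) (σ : Equiv.Perm (ι₁ ⊕ ι₂))
    (h : ∏ k, (if k ∈ S then fromBlocks A 0 0 0 else fromBlocks 0 0 0 C)
      (σ (e (k, 0))) (σ (e (k, 1))) ≠ 0) (x : κ × Fin 2) :
    (σ (e x)).isLeft ↔ x.1 ∈ S := by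
  obtain ⟨k, t⟩ := x
  have hk := Finset.prod_ne_zero_iff.1 h k (Finset.mem_univ k)
  by_cases hS : k ∈ S <;> fin_cases t <;>
    rcases h0 : σ (e (k, 0)) with a | a <;> rcases h1 : σ (e (k, 1)) with b | b <;>
    simp_all

section PfaffianSum

variable {κ κ' ι ι' : Type*} [Fintype κ] [Fintype κ'] [Fintype ι] [Fintype ι']
  [DecidableEq ι] [DecidableEq ι']

lemma pfaffianSum_submatrix (e : κ × Fin 2 ≃ ι) (f : ι ≃ ι') (M : κ → Matrix ι' ι' ℝ) :
    pfaffianSum e (fun k => (M k).submatrix f f) = pfaffianSum (e.trans f) M := by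
  unfold pfaffianSum
  refine Fintype.sum_equiv f.permCongr _ _ fun σ => ?_
  simp [Equiv.Perm.sign_permCongr]

lemma pfaffianSum_reindex (e : κ × Fin 2 ≃ ι) (g : κ' ≃ κ) (M : κ → Matrix ι ι ℝ) :
    pfaffianSum ((g.prodCongr (Equiv.refl _)).trans e) (fun k => M (g k)) = pfaffianSum e M := by
  unfold pfaffianSum
  refine Finset.sum_congr rfl fun σ _ => ?_
  congr 1
  exact Fintype.prod_equiv g _ _ fun k => by simp

lemma pfaffianSum_comp_perm [DecidableEq κ] (e : κ × Fin 2 ≃ ι) (g : Equiv.Perm κ)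
    (M : κ → Matrix ι ι ℝ) :
    pfaffianSum e (fun k => M (g k)) = pfaffianSum e M := by
  rw [← pfaffianSum_reindex e g M]
  unfold pfaffianSum
  refine (Fintype.sum_equiv
    (Equiv.mulRight (e.permCongr (Equiv.prodCongrLeft fun _ : Fin 2 => g))) _ _ fun σ => ?_).symm
  simp [Equiv.Perm.sign_permCongr, Equiv.Perm.sign_prodCongrLeft]

lemma pfaffianSum_congruence (e : κ × Fin 2 ≃ ι) (P M : Matrix ι ι ℝ) :
    pfaffianSum e (fun _ => P * M * Pᵀ) = P.det * pfaffianSum e (fun _ => M) := by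
  classical
  let E : (ι → ι) ≃ (κ → ι × ι) :=
    { toFun := fun h k => (h (e (k, 0)), h (e (k, 1)))
      invFun := fun f x => if (e.symm x).2 = 0 then (f (e.symm x).1).1 else (f (e.symm x).1).2
      left_inv := fun h => by
        funext x
        obtain ⟨⟨k, t⟩, rfl⟩ := e.surjective x
        fin_cases t <;> simp
      right_inv := fun f => by
        funext k
        simp }
  have entry (x y : ι) : (P * M * Pᵀ) x y = ∑ z : ι × ι, P x z.1 * P y z.2 * M z.1 z.2 := by
    simp only [Matrix.mul_apply, Matrix.transpose_apply, Finset.sum_mul]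
    rw [Fintype.sum_prod_type, Finset.sum_comm]
    exact Finset.sum_congr rfl fun _ _ => Finset.sum_congr rfl fun _ _ => by ring
  have expand (σ : Equiv.Perm ι) :
      ∏ k, (P * M * Pᵀ) (σ (e (k, 0))) (σ (e (k, 1))) =
        ∑ h : ι → ι, (∏ x, P (σ x) (h x)) * ∏ k, M (h (e (k, 0))) (h (e (k, 1))) := by
    simp only [entry]
    rw [Finset.prod_univ_sum, Fintype.piFinset_univ]
    refine (Fintype.sum_equiv E _ _ fun h => ?_).symm
    rw [← e.prod_comp, Fintype.prod_prod_type, ← Finset.prod_mul_distrib]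
    simp [E, Fin.prod_univ_two]
  have collect : pfaffianSum e (fun _ => P * M * Pᵀ) =
      ∑ h : ι → ι, (P.submatrix id h).det * ∏ k, M (h (e (k, 0))) (h (e (k, 1))) := by
    simp only [pfaffianSum, expand, Finset.mul_sum, Matrix.det_apply', Finset.sum_mul]
    rw [Finset.sum_comm]
    simp [mul_assoc]
  rw [collect, pfaffianSum, Finset.mul_sum]
  refine (Finset.sum_of_injOn (fun σ : Equiv.Perm ι => (σ : ι → ι))
    DFunLike.coe_injective.injOn (by simp) (fun h _ hh => ?_) fun σ _ => ?_).symm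
  · have hinj : ¬ Function.Injective h := fun hi =>
      hh ⟨Equiv.ofBijective h (Finite.injective_iff_bijective.1 hi), by simp, rfl⟩
    simp only [Function.Injective, not_forall] at hinj
    obtain ⟨x, y, hxy, hne⟩ := hinj
    rw [Matrix.det_zero_of_column_eq hne (by simp [hxy]), zero_mul]
  · rw [Matrix.det_permute']
    ring

variable {κ₁ κ₂ ι₁ ι₂ : Type*} [Fintype κ₁] [Fintype κ₂] [Fintype ι₁] [Fintype ι₂]
  [DecidableEq ι₁] [DecidableEq ι₂]

lemma pfaffianSum_ite_eq_zero [DecidableEq κ] (e : κ × Fin 2 ≃ ι₁ ⊕ ι₂) (A : Matrix ι₁ ι₁ ℝ)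
    (C : Matrix ι₂ ι₂ ℝ) (S : Finset κ) (hS : S.card * 2 ≠ Fintype.card ι₁) :
    pfaffianSum e (fun k => if k ∈ S then fromBlocks A 0 0 0 else fromBlocks 0 0 0 C) = 0 := by
  refine Finset.sum_eq_zero fun σ _ => mul_eq_zero_of_right _ ?_
  by_contra h
  have hl := isLeft_of_prod_ne_zero e A C S σ h
  apply hS
  have : (S ×ˢ (Finset.univ : Finset (Fin 2))).map (e.trans σ).toEmbedding =
      (Finset.univ : Finset ι₁).map Function.Embedding.inl := by
    ext y
    obtain ⟨x, rfl⟩ := (e.trans σ).surjective y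
    have := hl x
    simp only [Sum.isLeft_iff] at this
    simp [← this, eq_comm]
  simpa using congrArg Finset.card this

lemma pfaffianSum_sum_inl [DecidableEq κ₁] [DecidableEq κ₂] (e₁ : κ₁ × Fin 2 ≃ ι₁)
    (e₂ : κ₂ × Fin 2 ≃ ι₂) (A : Matrix ι₁ ι₁ ℝ) (C : Matrix ι₂ ι₂ ℝ) :
    pfaffianSum ((Equiv.sumProdDistrib κ₁ κ₂ (Fin 2)).trans (e₁.sumCongr e₂))
      (fun k => if k ∈ (Finset.univ : Finset κ₁).map Function.Embedding.inl
        then fromBlocks A 0 0 0 else fromBlocks 0 0 0 C) =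
      pfaffianSum e₁ (fun _ => A) * pfaffianSum e₂ (fun _ => C) := by
  simp only [pfaffianSum]
  rw [Finset.sum_mul_sum, ← Finset.sum_product']
  refine (Finset.sum_of_injOn (fun p => Equiv.Perm.sumCongrHom ι₁ ι₂ p)
    Equiv.Perm.sumCongrHom_injective.injOn (by simp) (fun σ _ hσ => ?_) fun p _ => ?_).symm
  · refine mul_eq_zero_of_right _ ?_
    by_contra h
    have hl := isLeft_of_prod_ne_zero _ A C _ σ h
    apply hσ
    have : σ ∈ (Equiv.Perm.sumCongrHom ι₁ ι₂).range := by
      apply Equiv.Perm.mem_sumCongrHom_range_of_perm_mapsTo_inl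
      rintro _ ⟨a, rfl⟩
      have := hl (Sum.inl (e₁.symm a).1, (e₁.symm a).2)
      obtain ⟨c, hc⟩ := Sum.isLeft_iff.1 (this.2 (by simp))
      exact ⟨c, by simpa using hc.symm⟩
    obtain ⟨p, rfl⟩ := this
    exact ⟨p, by simp, rfl⟩
  · simp [Fintype.prod_sum_type, Equiv.Perm.sign_sumCongr]
    ring

lemma pfaffianSum_fromBlocks_diagonal (e₁ : κ₁ × Fin 2 ≃ ι₁) (e₂ : κ₂ × Fin 2 ≃ ι₂)
    (A : Matrix ι₁ ι₁ ℝ) (C : Matrix ι₂ ι₂ ℝ) :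
    pfaffianSum ((Equiv.sumProdDistrib κ₁ κ₂ (Fin 2)).trans (e₁.sumCongr e₂))
      (fun _ => fromBlocks A 0 0 C) =
      (Fintype.card κ₁ + Fintype.card κ₂).choose (Fintype.card κ₁) *
        (pfaffianSum e₁ (fun _ => A) * pfaffianSum e₂ (fun _ => C)) := by
  classical
  set e := (Equiv.sumProdDistrib κ₁ κ₂ (Fin 2)).trans (e₁.sumCongr e₂)
  have hcard : Fintype.card ι₁ = Fintype.card κ₁ * 2 := by
    simpa using (Fintype.card_congr e₁).symm
  have expand : pfaffianSum e (fun _ => fromBlocks A 0 0 C) =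
      ∑ S : Finset (κ₁ ⊕ κ₂),
        pfaffianSum e (fun k => if k ∈ S then fromBlocks A 0 0 0 else fromBlocks 0 0 0 C) := by
    have hsum : fromBlocks A 0 0 C = fromBlocks A 0 0 0 + fromBlocks 0 0 0 C := by
      simp [Matrix.fromBlocks_add]
    simp only [pfaffianSum]
    rw [Finset.sum_comm]
    refine Finset.sum_congr rfl fun σ _ => ?_
    rw [← Finset.mul_sum]
    congr 1
    simp only [hsum, Matrix.add_apply]
    rw [Fintype.prod_add]
    refine Finset.sum_congr rfl fun S _ => ?_
    rw [← Finset.prod_mul_prod_compl S]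
    congr 1
    · exact Finset.prod_congr rfl fun k hk => by rw [if_pos hk]
    · exact Finset.prod_congr rfl fun k hk => by rw [if_neg (Finset.mem_compl.1 hk)]
  set S₀ : Finset (κ₁ ⊕ κ₂) := (Finset.univ : Finset κ₁).map Function.Embedding.inl with hS₀
  have hcard₀ : S₀.card = Fintype.card κ₁ := by simp [hS₀]
  have same (S : Finset (κ₁ ⊕ κ₂)) (hS : S.card = Fintype.card κ₁) :
      pfaffianSum e (fun k => if k ∈ S then fromBlocks A 0 0 0 else fromBlocks 0 0 0 C) =
        pfaffianSum e₁ (fun _ => A) * pfaffianSum e₂ (fun _ => C) := by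
    rw [← pfaffianSum_sum_inl]
    let E : {k // k ∈ S} ≃ {k // k ∈ S₀} := Finset.equivOfCardEq (hS.trans hcard₀.symm)
    refine Eq.trans ?_ (pfaffianSum_comp_perm e E.extendSubtype _)
    congr 1
    funext k
    have : E.extendSubtype k ∈ S₀ ↔ k ∈ S :=
      ⟨fun h => by_contra fun hk => E.extendSubtype_not_mem k hk h, E.extendSubtype_mem k⟩
    simp only [← hS₀, this]
  rw [expand, ← Finset.sum_subset (Finset.subset_univ
    (Finset.powersetCard (Fintype.card κ₁) Finset.univ))]
  · rw [Finset.sum_congr rfl fun S hS => same S (Finset.mem_powersetCard.1 hS).2]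
    simp
  · intro S _ hS
    refine pfaffianSum_ite_eq_zero e A C S fun h => hS ?_
    rw [hcard] at h
    exact Finset.mem_powersetCard.2 ⟨Finset.subset_univ S, by omega⟩

end PfaffianSum

lemma pfaffian_eq_pfaffianSum {k : ℕ} (M : Matrix (Fin (k * 2)) (Fin (k * 2)) ℝ) :
    pfaffian M = ((2 : ℝ) ^ k * k.factorial)⁻¹ * pfaffianSum finProdFinEquiv (fun _ => M) := by
  have hk : k * 2 / 2 = k := by omega
  unfold pfaffian pfaffianSum
  congr 1
  · rw [hk]
  · refine Finset.sum_congr rfl fun σ _ => ?_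
    congr 1
    refine Fintype.prod_equiv (finCongr hk) _ _ fun i => ?_
    have h₀ : finProdFinEquiv (finCongr hk i, (0 : Fin 2)) =
        (⟨2 * i, by have := i.isLt; omega⟩ : Fin (k * 2)) := Fin.ext (by simp)
    have h₁ : finProdFinEquiv (finCongr hk i, (1 : Fin 2)) =
        (⟨2 * i + 1, by have := i.isLt; omega⟩ : Fin (k * 2)) := Fin.ext (by simp; omega)
    rw [h₀, h₁]

lemma pfaffian_submatrix_finSumFinEquiv {a b : ℕ}
    (M : Matrix (Fin (a * 2) ⊕ Fin (b * 2)) (Fin (a * 2) ⊕ Fin (b * 2)) ℝ) :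
    pfaffian (M.submatrix finSumFinEquiv.symm finSumFinEquiv.symm) =
      ((2 : ℝ) ^ (a + b) * (a + b).factorial)⁻¹ *
        pfaffianSum ((Equiv.sumProdDistrib (Fin a) (Fin b) (Fin 2)).trans
          (finProdFinEquiv.sumCongr finProdFinEquiv)) (fun _ => M) := by
  have hab : (a + b) * 2 = a * 2 + b * 2 := by ring
  have cast {p q : ℕ} (h : p = q) (N : Matrix (Fin q) (Fin q) ℝ) :
      pfaffian N = pfaffian (N.submatrix (finCongr h) (finCongr h)) := by
    subst h; rfl
  rw [cast hab, pfaffian_eq_pfaffianSum]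
  congr 1
  rw [pfaffianSum_submatrix _ (finCongr hab) (fun _ => M.submatrix _ _),
    pfaffianSum_submatrix _ _ (fun _ => M),
    ← pfaffianSum_reindex _ finSumFinEquiv]
  congr 1
  ext ⟨i | i, t⟩ : 1
  · have : finCongr hab (finProdFinEquiv (Fin.castAdd b i, t)) =
        Fin.castAdd (b * 2) (finProdFinEquiv (i, t)) := Fin.ext (by simp)
    simp [-finCongr_apply, -finProdFinEquiv_apply_val, this]
  · have : finCongr hab (finProdFinEquiv (Fin.natAdd a i, t)) =
        Fin.natAdd (a * 2) (finProdFinEquiv (i, t)) := Fin.ext (by simp; ring)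
    simp [-finCongr_apply, -finProdFinEquiv_apply_val, this]

lemma fromBlocks_eq_congruence {ι₁ ι₂ : Type*} [Fintype ι₁] [Fintype ι₂] [DecidableEq ι₁]
    [DecidableEq ι₂] (A : Matrix ι₁ ι₁ ℝ) (At : Matrix ι₂ ι₂ ℝ) (B : Matrix ι₁ ι₂ ℝ)
    (hA : Aᵀ = -A) (hinv : IsUnit A.det) :
    fromBlocks A B (-Bᵀ) At =
      fromBlocks 1 0 (-(Bᵀ * A⁻¹)) 1 * fromBlocks A 0 0 (At + Bᵀ * A⁻¹ * B) *
        (fromBlocks 1 0 (-(Bᵀ * A⁻¹)) 1)ᵀ := by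
  have hA' : (A⁻¹)ᵀ = -A⁻¹ := by
    rw [Matrix.transpose_nonsing_inv, hA]
    refine Matrix.inv_eq_left_inv ?_
    rw [neg_mul_neg, Matrix.nonsing_inv_mul A hinv]
  have h₁ : A * (A⁻¹ * B) = B := Matrix.mul_nonsing_inv_cancel_left A B hinv
  have h₂ : Bᵀ * A⁻¹ * A = Bᵀ := Matrix.nonsing_inv_mul_cancel_right A Bᵀ hinv
  simp [Matrix.fromBlocks_transpose, Matrix.fromBlocks_multiply, Matrix.transpose_mul, hA', h₁, h₂,
    ← Matrix.mul_assoc]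

/-- **Pfaffian factorization for a block skew-symmetric matrix.**
For even `n, m`, `A` an invertible skew-symmetric `n × n` matrix, `Ã` skew-symmetric
`m × m`, and `B` an `n × m` matrix:
`Pf [[A, B], [-Bᵀ, Ã]] = Pf A · Pf (Ã + Bᵀ A⁻¹ B)`. -/
theorem stmt_4 (n m : ℕ) (hn : Even n) (hm : Even m)
    (A : Matrix (Fin n) (Fin n) ℝ) (At : Matrix (Fin m) (Fin m) ℝ)
    (B : Matrix (Fin n) (Fin m) ℝ)
    (hA : Aᵀ = -A) (hAt : Atᵀ = -At) (hinv : IsUnit A.det) :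
    pfaffian ((Matrix.fromBlocks A B (-Bᵀ) At).submatrix
        (finSumFinEquiv : Fin n ⊕ Fin m ≃ Fin (n + m)).symm
        (finSumFinEquiv : Fin n ⊕ Fin m ≃ Fin (n + m)).symm)
      = pfaffian A * pfaffian (At + Bᵀ * A⁻¹ * B) := by
  obtain ⟨a, rfl⟩ : ∃ a, n = a * 2 := hn.two_dvd.imp fun a h => h.trans (mul_comm 2 a)
  obtain ⟨b, rfl⟩ : ∃ b, m = b * 2 := hm.two_dvd.imp fun b h => h.trans (mul_comm 2 b)
  rw [pfaffian_submatrix_finSumFinEquiv, fromBlocks_eq_congruence A At B hA hinv,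
    pfaffianSum_congruence, pfaffianSum_fromBlocks_diagonal, pfaffian_eq_pfaffianSum,
    pfaffian_eq_pfaffianSum, Matrix.det_fromBlocks_zero₁₂, Fintype.card_fin, Fintype.card_fin]
  have hchoose : ((a + b).choose a * a.factorial * b.factorial : ℝ) = (a + b).factorial := by
    rw [Nat.choose_symm_add]
    exact_mod_cast Nat.add_choose_mul_factorial_mul_factorial a b
  rw [← hchoose]
  have h₀ : ((a + b).choose a : ℝ) ≠ 0 := by
    exact_mod_cast (Nat.choose_pos (Nat.le_add_right a b)).ne'
  have h₁ : (a.factorial : ℝ) ≠ 0 := by exact_mod_cast a.factorial_ne_zero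
  have h₂ : (b.factorial : ℝ) ≠ 0 := by exact_mod_cast b.factorial_ne_zero
  simp only [Matrix.det_one, one_mul]
  field_simp
  ring
end

section
/- Let m > n be natural numbers with m − n even, Z a skew-symmetric real m×m matrix, and W a real m×n matrix. Then the following Laplace-type expansion of the Pfaffian holds: Pf [[Z, W], [−Wᵀ, 0]] = Σ_{I ⊆ [m], |I| = m−n} (−1)^{Σ(I) + m(m−1)/2} Pf Z(I) · det W([m]∖I; [n]), where the sum runs over all (m−n)-element subsets I of [m], Σ(I) denotes the sum of the elements of I, Z(I) is the principal submatrix of Z on rows and columns indexed by I, and W([m]∖I; [n]) is the submatrix of W on the rows in [m]∖I. -/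
open Matrix

section PfaffianExpansion

open Equiv Equiv.Perm

/-- The sign of a permutation that is increasing on the first `a` and on the last `b` indices. -/
theorem sign_eq_of_strictMono_castAdd_natAdd {a b : ℕ} (ρ : Perm (Fin (a + b)))
    (hf : StrictMono fun i => ρ (Fin.castAdd b i)) (hg : StrictMono fun j => ρ (Fin.natAdd a j)) :
    sign ρ = (-1) ^ ∑ i : Fin a, ((ρ (Fin.castAdd b i) : ℕ) + i) := by
  have hcount : ∀ i : Fin a, ((ρ (Fin.castAdd b i)) : ℕ) =
      i + (Finset.univ.filter fun j : Fin b => ρ (Fin.natAdd a j) < ρ (Fin.castAdd b i)).card := by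
    intro i
    have h1 : ∀ {N : ℕ} (y : Fin N), (∑ x : Fin N, if x < y then 1 else 0) = (y : ℕ) := by
      intro N y
      rw [← Finset.card_filter, ← Fin.card_Iio y]
      congr 1
      ext; simp
    rw [← h1 (ρ (Fin.castAdd b i)), ← Equiv.sum_comp ρ, Fin.sum_univ_add, Finset.card_filter,
      ← h1 i]
    simp only [hf.lt_iff_lt]
  have hcast : ∀ i : Fin a, (∏ j ∈ Finset.Ioi (Fin.castAdd b i),
      (if ρ (Fin.castAdd b i) < ρ j then 1 else -1 : ℤˣ)) =
      (-1) ^ ((ρ (Fin.castAdd b i) : ℕ) + i) := by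
    intro i
    have : Finset.Ioi (Fin.castAdd b i) = Finset.univ.filter (Fin.castAdd b i < ·) := by
      ext; simp
    rw [this, Finset.prod_filter, Fin.prod_univ_add, Finset.prod_eq_one, one_mul]
    · have hlt : ∀ j, Fin.castAdd b i < Fin.natAdd a j := fun j => by
        rw [Fin.lt_def]; simp; omega
      have hite : ∀ j, (if ρ (Fin.castAdd b i) < ρ (Fin.natAdd a j) then 1 else -1 : ℤˣ) =
          if ρ (Fin.natAdd a j) < ρ (Fin.castAdd b i) then -1 else 1 := fun j => by
        have : ρ (Fin.castAdd b i) ≠ ρ (Fin.natAdd a j) := ρ.injective.ne (hlt j).ne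
        grind
      simp only [hlt, if_true, hite]
      rw [← Finset.prod_filter, Finset.prod_const, hcount i, add_right_comm, pow_add,
        ← two_mul, pow_mul]
      simp
    · intro j _
      split_ifs with h1 h2
      · rfl
      · exact absurd (hf (show i < j from h1)) h2
      · rfl
  rw [sign_eq_prod_prod_Ioi, Fin.prod_univ_add, Finset.prod_congr rfl fun i _ => hcast i,
    Finset.prod_pow_eq_pow_sum, mul_eq_left]
  refine Finset.prod_eq_one fun j _ => Finset.prod_eq_one fun x hx => ?_
  induction x using Fin.addCases with
  | left i =>
    rw [Finset.mem_Ioi, Fin.lt_def] at hx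
    simp at hx
    omega
  | right i => rw [if_pos (hg (by simpa using hx))]

/-- The `2 * q` indices `0, …, N - 1`, grouped in consecutive pairs labelled by `P`. -/
def pairSlot {P : Type*} {q N : ℕ} (e : P ≃ Fin q) (h : q * 2 = N) : P × Fin 2 ≃ Fin N :=
  ((e.prodCongr (Equiv.refl _)).trans finProdFinEquiv).trans (finCongr h)

theorem pairSlot_val {P : Type*} {q N : ℕ} (e : P ≃ Fin q) (h : q * 2 = N) (x : P × Fin 2) :
    (pairSlot e h x : ℕ) = x.2 + 2 * e x.1 := rfl

/-- The Pfaffian with its pairs of indices labelled by an arbitrary type `P`. -/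
theorem pfaffian_eq_sum_pairSlot {P : Type*} [Fintype P] {q N : ℕ} (e : P ≃ Fin q)
    (h : q * 2 = N) (M : Matrix (Fin N) (Fin N) ℝ) :
    pfaffian M = ((2 : ℝ) ^ q * q.factorial)⁻¹ * ∑ σ : Perm (Fin N), ((sign σ : ℤ) : ℝ) *
      ∏ p, M (σ (pairSlot e h (p, 0))) (σ (pairSlot e h (p, 1))) := by
  obtain rfl : q = N / 2 := by omega
  rw [pfaffian]
  congr 1
  refine Finset.sum_congr rfl fun σ _ => congrArg _ ?_
  refine (Fintype.prod_equiv e _ _ fun p => ?_).symm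
  congr 2 <;> ext <;> simp [pairSlot_val, add_comm]

/-- Permuting the pairs by `π` and the two slots inside the pair `p` by `ε p`. -/
def pairPerm {P : Type*} (π : Perm P) (ε : P → Perm (Fin 2)) : Perm (P × Fin 2) :=
  (prodCongrRight ε).trans (prodCongrLeft fun _ => π)

theorem sign_pairPerm {P : Type*} [Fintype P] [DecidableEq P] (π : Perm P)
    (ε : P → Perm (Fin 2)) : sign (pairPerm π ε) = ∏ p, sign (ε p) := by
  rw [pairPerm, sign_trans, sign_prodCongrLeft, sign_prodCongrRight]
  simp

section PairSum

variable {P X : Type*} [Fintype P] [DecidableEq P] [Fintype X] [DecidableEq X]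

/-- The term of `σ` in the Pfaffian sum, up to normalisation, for slots labelled by `s`. -/
def pfTerm (s : P × Fin 2 ≃ X) (M : Matrix X X ℝ) (σ : Perm X) : ℝ :=
  ((sign σ : ℤ) : ℝ) * ∏ p, M (σ (s (p, 0))) (σ (s (p, 1)))

/-- Pfaffian terms of a skew-symmetric matrix are invariant under permutations preserving the pairs. -/
theorem pfTerm_mul_pairPerm (s : P × Fin 2 ≃ X) {M : Matrix X X ℝ} (hM : Mᵀ = -M)
    (π : Perm P) (ε : P → Perm (Fin 2)) (σ : Perm X) :
    pfTerm s M (σ * s.permCongr (pairPerm π ε)) = pfTerm s M σ := by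
  have hskew : ∀ x y, M y x = -M x y := fun x y => congrFun₂ hM x y
  have hpair : ∀ (δ : Perm (Fin 2)) (f : Fin 2 → X),
      M (f (δ 0)) (f (δ 1)) = ((sign δ : ℤ) : ℝ) * M (f 0) (f 1) := by
    intro δ f
    have hδ : δ = 1 ∨ δ = swap 0 1 := by revert δ; decide
    obtain rfl | rfl := hδ
    · simp
    · simp [hskew (f 0) (f 1)]
  have hfac : ∀ p, M ((σ * s.permCongr (pairPerm π ε)) (s (p, 0)))
      ((σ * s.permCongr (pairPerm π ε)) (s (p, 1))) =
      ((sign (ε p) : ℤ) : ℝ) * M (σ (s (π p, 0))) (σ (s (π p, 1))) := by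
    intro p
    rw [← hpair (ε p) fun x => σ (s (π p, x))]
    simp [pairPerm]
  have hsq : ((∏ p, sign (ε p) : ℤˣ) : ℤ) * ((∏ p, sign (ε p) : ℤˣ) : ℤ) = 1 := by
    rw [← Units.val_mul, Int.units_mul_self, Units.val_one]
  rw [pfTerm, pfTerm, Finset.prod_congr rfl fun p _ => hfac p, Finset.prod_mul_distrib,
    Equiv.prod_comp π fun p => M (σ (s (p, 0))) (σ (s (p, 1))), Perm.sign_mul, sign_permCongr,
    sign_pairPerm]
  have hsq' := congrArg (Int.cast : ℤ → ℝ) hsq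
  push_cast at hsq' ⊢
  linear_combination ((sign σ : ℤ) : ℝ) * (∏ p, M (σ (s (p, 0))) (σ (s (p, 1)))) * hsq'

/-- If `M` vanishes on the indices `c b`, the Pfaffian sum is a multiple of its part over the
permutations that put each `c b` in the second slot of the pair `Sum.inr b`. -/
theorem sum_pfTerm_eq_mul_sum_filter {A B : Type*} [Fintype A] [Fintype B] [DecidableEq A]
    [DecidableEq B] (s : (A ⊕ B) × Fin 2 ≃ X) {M : Matrix X X ℝ} (hM : Mᵀ = -M) {c : B → X}
    (hc : Function.Injective c) (hMc : ∀ b b', M (c b) (c b') = 0)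
    [DecidablePred fun σ : Perm X => ∀ b, σ (s (Sum.inr b, 1)) = c b] :
    ∑ σ, pfTerm s M σ =
      ((Fintype.card (A ⊕ B)).descFactorial (Fintype.card B) * 2 ^ Fintype.card B : ℕ) *
        ∑ σ with ∀ b, σ (s (Sum.inr b, 1)) = c b, pfTerm s M σ := by
  classical
  have hfiber : ∀ d : B → (A ⊕ B) × Fin 2,
      ∑ σ with (fun b => s.symm (σ.symm (c b))) = d, pfTerm s M σ =
        if Function.Injective (Prod.fst ∘ d) then
          ∑ σ with ∀ b, σ (s (Sum.inr b, 1)) = c b, pfTerm s M σ else 0 := by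
    intro d
    have hd : ∀ σ : Perm X,
        (fun b => s.symm (σ.symm (c b))) = d ↔ ∀ b, σ (s (d b)) = c b := fun σ => by
      rw [funext_iff]
      refine forall_congr' fun b => ?_
      rw [Equiv.symm_apply_eq, Equiv.symm_apply_eq, eq_comm]
    simp only [hd]
    split_ifs with hinj
    · obtain ⟨π, hπ⟩ := Perm.exists_extending_pair (Sum.inr : B → A ⊕ B) (Prod.fst ∘ d)
        Sum.inr_injective hinj
      let ε : A ⊕ B → Perm (Fin 2) := Sum.elim (fun _ => 1) fun b => swap 1 (d b).2
      let γ := s.permCongr (pairPerm π ε)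
      have hγ : ∀ b, γ (s (Sum.inr b, 1)) = s (d b) := fun b => by
        simp [γ, pairPerm, ε]
        exact Prod.ext (by simpa using hπ b) rfl
      refine Finset.sum_equiv (Equiv.mulRight γ) (fun σ => ?_) fun σ _ =>
        (pfTerm_mul_pairPerm s hM π ε σ).symm
      simp [hγ]
    · refine Finset.sum_eq_zero fun σ hσ => ?_
      rw [Finset.mem_filter_univ] at hσ
      simp only [Function.Injective, Function.comp_apply, not_forall] at hinj
      obtain ⟨b, b', hbb', hne⟩ := hinj
      refine mul_eq_zero_of_right _ (Finset.prod_eq_zero (Finset.mem_univ (d b).1) ?_)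
      have hsnd : (d b).2 ≠ (d b').2 := fun h =>
        hne (hc (by rw [← hσ, ← hσ, Prod.ext hbb' h]))
      have h0 : ∀ x : Fin 2, ∃ b'', σ (s ((d b).1, x)) = c b'' := by
        intro x
        obtain h | h : x = (d b).2 ∨ x = (d b').2 := by omega
        · exact ⟨b, by rw [h, hσ]⟩
        · exact ⟨b', by rw [h, hbb', hσ]⟩
      obtain ⟨u, hu⟩ := h0 0
      obtain ⟨v, hv⟩ := h0 1
      rw [hu, hv, hMc]
  let toData : {d : B → (A ⊕ B) × Fin 2 // Function.Injective (Prod.fst ∘ d)} ≃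
      (B ↪ A ⊕ B) × (B → Fin 2) :=
    { toFun := fun d => (⟨_, d.2⟩, Prod.snd ∘ d.1)
      invFun := fun x => ⟨fun b => (x.1 b, x.2 b), x.1.injective⟩
      left_inv := fun _ => rfl
      right_inv := fun _ => rfl }
  rw [← Finset.sum_fiberwise Finset.univ fun σ b => s.symm (σ.symm (c b)),
    Finset.sum_congr rfl fun d _ => hfiber d, ← Finset.sum_filter, Finset.sum_const,
    nsmul_eq_mul, ← Fintype.card_subtype, Fintype.card_congr toData]
  simp [Fintype.card_embedding_eq]

end PairSum

/-- The permutation of `Fin (a + n)` acting as `α` on the first `a` and as `β` on the last `n`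
indices. -/
def blockPerm {a n : ℕ} (α : Perm (Fin a)) (β : Perm (Fin n)) : Perm (Fin (a + n)) :=
  finSumFinEquiv.permCongr (Equiv.sumCongr α β)

section Shuffle

variable {a n : ℕ}

@[simp]
theorem blockPerm_castAdd (α : Perm (Fin a)) (β : Perm (Fin n)) (i : Fin a) :
    blockPerm α β (Fin.castAdd n i) = Fin.castAdd n (α i) := by
  simp [blockPerm]

@[simp]
theorem blockPerm_natAdd (α : Perm (Fin a)) (β : Perm (Fin n)) (j : Fin n) :
    blockPerm α β (Fin.natAdd a j) = Fin.natAdd a (β j) := by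
  simp [blockPerm]

theorem sign_blockPerm (α : Perm (Fin a)) (β : Perm (Fin n)) :
    sign (blockPerm α β) = sign α * sign β := by
  rw [blockPerm, sign_permCongr]
  exact sign_sumCongr α β

theorem blockPerm_injective :
    Function.Injective fun x : Perm (Fin a) × Perm (Fin n) => blockPerm x.1 x.2 :=
  finSumFinEquiv.permCongr.injective.comp sumCongrHom_injective

theorem exists_blockPerm_eq {σ : Perm (Fin (a + n))}
    (hσ : ∀ i : Fin a, ∃ i' : Fin a, σ (Fin.castAdd n i) = Fin.castAdd n i') :
    ∃ α β, blockPerm α β = σ := by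
  have hmem : finSumFinEquiv.symm.permCongr σ ∈ (sumCongrHom (Fin a) (Fin n)).range := by
    refine mem_sumCongrHom_range_of_perm_mapsTo_inl ?_
    rintro _ ⟨i, rfl⟩
    obtain ⟨i', hi'⟩ := hσ i
    exact ⟨i', by simp [hi']⟩
  obtain ⟨⟨α, β⟩, h⟩ := hmem
  refine ⟨α, β, ?_⟩
  rw [blockPerm, show Equiv.sumCongr α β = finSumFinEquiv.symm.permCongr σ from h]
  ext; simp

/-- The permutation listing first `I` and then its complement, both in increasing order. -/
def shuffle (I : Finset (Fin (a + n))) (hI : I.card = a) (hIc : Iᶜ.card = n) :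
    Perm (Fin (a + n)) :=
  finSumFinEquiv.symm.trans (finSumEquivOfFinset hI hIc)

@[simp]
theorem shuffle_castAdd (I : Finset (Fin (a + n))) (hI : I.card = a) (hIc : Iᶜ.card = n)
    (i : Fin a) : shuffle I hI hIc (Fin.castAdd n i) = I.orderEmbOfFin hI i := by
  simp [shuffle]

@[simp]
theorem shuffle_natAdd (I : Finset (Fin (a + n))) (hI : I.card = a) (hIc : Iᶜ.card = n)
    (j : Fin n) : shuffle I hI hIc (Fin.natAdd a j) = Iᶜ.orderEmbOfFin hIc j := by
  simp [shuffle]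

theorem sign_shuffle (I : Finset (Fin (a + n))) (hI : I.card = a) (hIc : Iᶜ.card = n) :
    sign (shuffle I hI hIc) = (-1) ^ (∑ i ∈ I, (i : ℕ) + a * (a - 1) / 2) := by
  have hsum : ∑ i ∈ I, (i : ℕ) = ∑ i : Fin a, (I.orderEmbOfFin hI i : ℕ) := by
    rw [← Finset.sum_coe_sort]
    exact (Equiv.sum_comp (I.orderIsoOfFin hI).toEquiv fun x => ((x : Fin (a + n)) : ℕ)).symm
  rw [sign_eq_of_strictMono_castAdd_natAdd]
  · simp only [shuffle_castAdd]
    rw [Finset.sum_add_distrib, hsum, ← Finset.sum_range_id, Finset.sum_range]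
  · simpa using (I.orderEmbOfFin hI).strictMono
  · simpa using (Iᶜ.orderEmbOfFin hIc).strictMono

theorem card_compl_of_mem_powersetCard {I : Finset (Fin (a + n))}
    (hI : I ∈ Finset.powersetCard a Finset.univ) : Iᶜ.card = n := by
  rw [Finset.card_compl, (Finset.mem_powersetCard.mp hI).2, Fintype.card_fin, Nat.add_sub_cancel_left]

/-- Permutations of `Fin (a + n)`, sorted by the image of the first `a` indices. -/
theorem sum_perm_eq_sum_shuffle_mul_blockPerm {R : Type*} [AddCommMonoid R]
    (φ : Perm (Fin (a + n)) → R) :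
    ∑ τ, φ τ = ∑ I ∈ (Finset.powersetCard a (Finset.univ : Finset (Fin (a + n)))).attach,
      ∑ x : Perm (Fin a) × Perm (Fin n),
        φ (shuffle I.1 (Finset.mem_powersetCard.mp I.2).2 (card_compl_of_mem_powersetCard I.2) *
          blockPerm x.1 x.2) := by
  let img : Perm (Fin (a + n)) → Finset (Fin (a + n)) := fun τ =>
    Finset.univ.map ((Fin.castAddEmb n).trans τ.toEmbedding)
  have himg : ∀ τ ∈ Finset.univ, img τ ∈ Finset.powersetCard a Finset.univ := fun τ _ =>
    Finset.mem_powersetCard.mpr ⟨Finset.subset_univ _, by simp [img]⟩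
  rw [← Finset.sum_fiberwise_of_maps_to himg, ← Finset.sum_attach]
  refine Finset.sum_congr rfl fun ⟨I, hI⟩ _ => ?_
  have hcard := (Finset.mem_powersetCard.mp hI).2
  have hcardc := card_compl_of_mem_powersetCard hI
  have hmem : ∀ i, (shuffle I hcard hcardc) (Fin.castAdd n i) ∈ I := fun i => by simp
  symm
  refine Finset.sum_nbij (fun x => shuffle I hcard hcardc * blockPerm x.1 x.2) ?_ ?_ ?_
    fun _ _ => rfl
  · intro x _
    rw [Finset.mem_filter_univ]
    refine Finset.eq_of_subset_of_card_le (fun y hy => ?_) (by simp [img, hcard])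
    obtain ⟨i, _, rfl⟩ := Finset.mem_map.mp hy
    simp
  · exact ((mul_right_injective _).comp blockPerm_injective).injOn
  · intro τ hτ
    have hτ : img τ = I := by simpa using hτ
    obtain ⟨α, β, h⟩ := exists_blockPerm_eq (σ := (shuffle I hcard hcardc)⁻¹ * τ) fun i => by
      have hi : τ (Fin.castAdd n i) ∈ I := by
        rw [← hτ]
        exact Finset.mem_map_of_mem _ (Finset.mem_univ i)
      have : τ (Fin.castAdd n i) ∈ Set.range (I.orderEmbOfFin hcard) := by simpa using hi
      obtain ⟨i', hi'⟩ := this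
      refine ⟨i', ?_⟩
      rw [Perm.mul_apply, Perm.inv_eq_iff_eq, shuffle_castAdd, hi']
    exact ⟨(α, β), by simp, by simp [h]⟩

/-- The permutation sending `0, …, a + n - 1` to `0, …, a - 1, a, a + 2, …, a + 2 * (n - 1)`
and the remaining indices to `a + 1, a + 3, …`. -/
theorem exists_interleaving_perm (a n : ℕ) : ∃ ρ : Perm (Fin (a + n + n)),
    (∀ i : Fin (a + n), (ρ (Fin.castAdd n i) : ℕ) = i + (i - a)) ∧
    (∀ j : Fin n, (ρ (Fin.natAdd (a + n) j) : ℕ) = a + 2 * j + 1) ∧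
    sign ρ = (-1) ^ (n * (n - 1) / 2) := by
  let f : Fin (a + n) ⊕ Fin n → Fin (a + n + n) :=
    Sum.elim (fun i => ⟨i + (i - a), by omega⟩) fun j => ⟨a + 2 * j + 1, by omega⟩
  have hf : Function.Injective f := by
    rintro (i | i) (j | j) h <;> simp [f] at h ⊢ <;> omega
  let ρ : Perm (Fin (a + n + n)) := finSumFinEquiv.symm.trans (Equiv.ofBijective f
    ((Fintype.bijective_iff_injective_and_card f).mpr ⟨hf, by simp⟩))
  have hl : ∀ i : Fin (a + n), (ρ (Fin.castAdd n i) : ℕ) = i + (i - a) := fun i => by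
    simp [ρ, f]
  have hr : ∀ j : Fin n, (ρ (Fin.natAdd (a + n) j) : ℕ) = a + 2 * j + 1 := fun j => by
    simp [ρ, f]
  refine ⟨ρ, hl, hr, ?_⟩
  rw [sign_eq_of_strictMono_castAdd_natAdd]
  · simp only [hl]
    rw [Fin.sum_univ_add, ← Finset.sum_range_id, Finset.sum_range, pow_add]
    have h1 : ∀ i : Fin a, (Fin.castAdd n i : ℕ) + (Fin.castAdd n i - a) + Fin.castAdd n i =
        2 * i := fun i => by simp; omega
    have h2 : ∀ j : Fin n, (Fin.natAdd a j : ℕ) + (Fin.natAdd a j - a) + Fin.natAdd a j =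
        2 * (a + j) + j := fun i => by simp; omega
    simp only [h1, h2]
    rw [Finset.sum_add_distrib, ← Finset.mul_sum, ← Finset.mul_sum, pow_add, pow_mul, pow_mul]
    simp
  · intro i j h
    rw [Fin.lt_def] at h ⊢
    rw [hl, hl]
    omega
  · intro i j h
    rw [Fin.lt_def] at h ⊢
    rw [hr, hr]
    omega

end Shuffle

section Block

variable {k n : ℕ}

/-- The slots of the `k` pairs of indices of a `k * 2`-square matrix. -/
abbrev stdSlot (k : ℕ) : Fin k × Fin 2 ≃ Fin (k * 2) := pairSlot (Equiv.refl (Fin k)) rfl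

theorem pfaffian_fromBlocks_eq_sum (Z : Matrix (Fin (k * 2 + n)) (Fin (k * 2 + n)) ℝ)
    (hZ : Zᵀ = -Z) (W : Matrix (Fin (k * 2 + n)) (Fin n) ℝ) :
    pfaffian ((Matrix.fromBlocks Z W (-Wᵀ) 0).submatrix
        (finSumFinEquiv : Fin (k * 2 + n) ⊕ Fin n ≃ Fin (k * 2 + n + n)).symm
        (finSumFinEquiv : Fin (k * 2 + n) ⊕ Fin n ≃ Fin (k * 2 + n + n)).symm) =
      ((2 : ℝ) ^ k * k.factorial)⁻¹ * ∑ τ : Perm (Fin (k * 2 + n)),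
        (-1) ^ (n * (n - 1) / 2) * ((sign τ : ℤ) : ℝ) *
          (∏ i, Z (τ (Fin.castAdd n (stdSlot k (i, 0)))) (τ (Fin.castAdd n (stdSlot k (i, 1))))) *
            ∏ j, W (τ (Fin.natAdd (k * 2) j)) j := by
  set M := (Matrix.fromBlocks Z W (-Wᵀ) 0).submatrix
    (finSumFinEquiv : Fin (k * 2 + n) ⊕ Fin n ≃ Fin (k * 2 + n + n)).symm
    (finSumFinEquiv : Fin (k * 2 + n) ⊕ Fin n ≃ Fin (k * 2 + n + n)).symm with hMdef
  have hM : Mᵀ = -M := by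
    rw [hMdef, Matrix.transpose_submatrix, Matrix.fromBlocks_transpose, hZ,
      Matrix.transpose_neg, Matrix.transpose_transpose, Matrix.transpose_zero]
    ext x y
    simp only [Matrix.submatrix_apply, Matrix.neg_apply]
    rcases finSumFinEquiv.symm x with i | i <;> rcases finSumFinEquiv.symm y with j | j <;> simp
  have hN : (k + n) * 2 = k * 2 + n + n := by ring
  let s : (Fin k ⊕ Fin n) × Fin 2 ≃ Fin (k * 2 + n + n) := pairSlot finSumFinEquiv hN
  obtain ⟨ρ, hl, hr, hsign⟩ := exists_interleaving_perm (k * 2) n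
  have hs : ∀ i x, s (Sum.inl i, x) = ρ (Fin.castAdd n (Fin.castAdd n (stdSlot k (i, x)))) := by
    intro i x
    ext
    rw [hl]
    simp [s, pairSlot_val]
    omega
  have hs0 : ∀ j, s (Sum.inr j, 0) = ρ (Fin.castAdd n (Fin.natAdd (k * 2) j)) := by
    intro j
    ext
    rw [hl]
    simp [s, pairSlot_val]
    omega
  have hs1 : ∀ j, s (Sum.inr j, 1) = ρ (Fin.natAdd (k * 2 + n) j) := by
    intro j
    ext
    rw [hr]
    simp [s, pairSlot_val]
    omega
  have hfilter : ∑ σ with ∀ j, σ (s (Sum.inr j, 1)) = Fin.natAdd (k * 2 + n) j, pfTerm s M σ =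
      ∑ τ : Perm (Fin (k * 2 + n)), pfTerm s M (blockPerm τ 1 * ρ⁻¹) := by
    symm
    refine Finset.sum_nbij (fun τ => blockPerm τ 1 * ρ⁻¹) ?_ ?_ ?_ fun _ _ => rfl
    · intro τ _
      simp [hs1]
    · intro τ _ τ' _ h
      exact congrArg Prod.fst (blockPerm_injective (a₁ := (τ, 1)) (a₂ := (τ', 1))
        (mul_left_injective _ h))
    · intro σ hσ
      have hσ' : ∀ j, (σ * ρ) (Fin.natAdd (k * 2 + n) j) = Fin.natAdd (k * 2 + n) j := by
        simpa [hs1] using hσ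
      obtain ⟨α, β, h⟩ := exists_blockPerm_eq (σ := σ * ρ) fun i => by
        obtain ⟨y, hy⟩ : ∃ y, y = (σ * ρ) (Fin.castAdd n i) := ⟨_, rfl⟩
        rw [← hy]
        induction y using Fin.addCases with
        | left i' => exact ⟨i', rfl⟩
        | right j =>
          rw [← hσ' j] at hy
          have := congrArg Fin.val ((σ * ρ).injective hy)
          simp at this
          omega
      have hβ : β = 1 := by
        ext j
        have := hσ' j
        rw [← h, blockPerm_natAdd] at this
        simpa [Fin.ext_iff] using this
      subst hβ
      exact ⟨α, by simp, by simp [h]⟩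
  have hterm : ∀ τ : Perm (Fin (k * 2 + n)), pfTerm s M (blockPerm τ 1 * ρ⁻¹) =
      (-1) ^ (n * (n - 1) / 2) * ((sign τ : ℤ) : ℝ) *
        (∏ i, Z (τ (Fin.castAdd n (stdSlot k (i, 0)))) (τ (Fin.castAdd n (stdSlot k (i, 1))))) *
          ∏ j, W (τ (Fin.natAdd (k * 2) j)) j := by
    intro τ
    rw [pfTerm, Fintype.prod_sum_type, Perm.sign_mul, sign_blockPerm, Perm.sign_inv, hsign]
    simp only [hs, hs0, hs1, Perm.mul_apply, Perm.inv_def, Equiv.symm_apply_apply, blockPerm_castAdd,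
      blockPerm_natAdd, Perm.one_apply, hMdef, Matrix.submatrix_apply,
      finSumFinEquiv_symm_apply_castAdd, finSumFinEquiv_symm_apply_natAdd,
      Matrix.fromBlocks_apply₁₁, Matrix.fromBlocks_apply₁₂]
    push_cast
    simp
    ring
  have hsum := sum_pfTerm_eq_mul_sum_filter s hM (c := Fin.natAdd (k * 2 + n))
    (Fin.natAdd_injective _ _) fun j j' => by simp [hMdef]
  rw [hfilter, Finset.sum_congr rfl fun τ _ => hterm τ] at hsum
  rw [pfaffian_eq_sum_pairSlot finSumFinEquiv hN]
  change _ * ∑ σ, pfTerm s M σ = _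
  rw [hsum, ← mul_assoc]
  congr 1
  have hfact := Nat.factorial_mul_descFactorial (Nat.le_add_left n k)
  rw [Nat.add_sub_cancel] at hfact
  have hne : ((k + n).factorial : ℝ) ≠ 0 := by exact_mod_cast (k + n).factorial_ne_zero
  have hne' : (k.factorial : ℝ) ≠ 0 := by exact_mod_cast k.factorial_ne_zero
  rw [inv_mul_eq_div, inv_eq_one_div, div_eq_div_iff (by positivity) (by positivity)]
  rw [← hfact]
  simp only [Fintype.card_sum, Fintype.card_fin]
  push_cast
  ring

theorem neg_one_pow_shuffle_exponent (k n S : ℕ) :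
    (-1 : ℝ) ^ (n * (n - 1) / 2) * (-1) ^ (S + k * 2 * (k * 2 - 1) / 2) =
      (-1) ^ (S + k * 2 + (k * 2 + n) * (k * 2 + n - 1) / 2) := by
  have h : (k * 2 + n) * (k * 2 + n - 1) / 2 =
      k * 2 * (k * 2 - 1) / 2 + n * (n - 1) / 2 + 2 * (k * n) := by
    simp only [← Finset.sum_range_id]
    rw [Finset.sum_range_add, Finset.sum_add_distrib]
    simp
    ring
  rw [h, ← pow_add, show S + k * 2 + (k * 2 * (k * 2 - 1) / 2 + n * (n - 1) / 2 + 2 * (k * n)) =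
    n * (n - 1) / 2 + (S + k * 2 * (k * 2 - 1) / 2) + 2 * (k + k * n) by ring, pow_add _ _ (2 * _),
    pow_mul _ 2]
  simp

theorem pfaffian_fromBlocks_eq_sum_pfaffian_mul_det
    (Z : Matrix (Fin (k * 2 + n)) (Fin (k * 2 + n)) ℝ) (hZ : Zᵀ = -Z)
    (W : Matrix (Fin (k * 2 + n)) (Fin n) ℝ) :
    pfaffian ((Matrix.fromBlocks Z W (-Wᵀ) 0).submatrix
        (finSumFinEquiv : Fin (k * 2 + n) ⊕ Fin n ≃ Fin (k * 2 + n + n)).symm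
        (finSumFinEquiv : Fin (k * 2 + n) ⊕ Fin n ≃ Fin (k * 2 + n + n)).symm) =
      ∑ I ∈ (Finset.powersetCard (k * 2) (Finset.univ : Finset (Fin (k * 2 + n)))).attach,
        (-1 : ℝ) ^ ((∑ i ∈ I.1, ((i : ℕ) + 1)) + (k * 2 + n) * (k * 2 + n - 1) / 2) *
          pfaffian (Z.submatrix (I.1.orderEmbOfFin (Finset.mem_powersetCard.mp I.2).2)
            (I.1.orderEmbOfFin (Finset.mem_powersetCard.mp I.2).2)) *
          Matrix.det (W.submatrix
            (I.1ᶜ.orderEmbOfFin (card_compl_of_mem_powersetCard I.2)) id) := by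
  rw [pfaffian_fromBlocks_eq_sum Z hZ W, sum_perm_eq_sum_shuffle_mul_blockPerm, Finset.mul_sum]
  refine Finset.sum_congr rfl fun ⟨I, hI⟩ _ => ?_
  have hcard := (Finset.mem_powersetCard.mp hI).2
  have hexp : ∑ i ∈ I, ((i : ℕ) + 1) = ∑ i ∈ I, (i : ℕ) + k * 2 := by
    rw [Finset.sum_add_distrib, Finset.sum_const, hcard, smul_eq_mul, mul_one]
  rw [pfaffian_eq_sum_pairSlot (Equiv.refl (Fin k)) rfl, Matrix.det_apply', hexp,
    ← neg_one_pow_shuffle_exponent, mul_left_comm,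
    mul_assoc, mul_assoc, Finset.sum_mul_sum, ← Fintype.sum_prod_type', Finset.mul_sum,
    Finset.mul_sum, Finset.mul_sum]
  refine Finset.sum_congr rfl fun x _ => ?_
  rw [Perm.sign_mul, sign_blockPerm, sign_shuffle]
  simp only [Perm.mul_apply, blockPerm_castAdd, blockPerm_natAdd, shuffle_castAdd, shuffle_natAdd,
    Matrix.submatrix_apply, id]
  push_cast
  ring

end Block

end PfaffianExpansion

/-- **Laplace-type expansion of the Pfaffian** (Okada).
For `m > n` with `m - n` even, `Z` skew-symmetric `m × m` and `W` an `m × n` matrix: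
`Pf [[Z, W], [-Wᵀ, 0]] = Σ_{I ⊆ [m], |I| = m-n} (-1)^{Σ(I) + m(m-1)/2} Pf Z(I) · det W([m]∖I; [n])`,
where elements of `[m]` are counted `1, …, m` (so `i : Fin m` contributes `i + 1` to `Σ(I)`),
and submatrices keep rows/columns in increasing order. -/
theorem stmt_6 (m n : ℕ) (hmn : n < m) (heven : Even (m - n))
    (Z : Matrix (Fin m) (Fin m) ℝ) (hZ : Zᵀ = -Z) (W : Matrix (Fin m) (Fin n) ℝ) :
    pfaffian ((Matrix.fromBlocks Z W (-Wᵀ) 0).submatrix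
        (finSumFinEquiv : Fin m ⊕ Fin n ≃ Fin (m + n)).symm
        (finSumFinEquiv : Fin m ⊕ Fin n ≃ Fin (m + n)).symm)
      = ∑ I ∈ (Finset.powersetCard (m - n) (Finset.univ : Finset (Fin m))).attach,
          (-1 : ℝ) ^ ((∑ i ∈ I.1, ((i : ℕ) + 1)) + m * (m - 1) / 2) *
            pfaffian (Z.submatrix
              (fun k : Fin (m - n) => (I.1.orderIsoOfFin (Finset.mem_powersetCard.mp I.2).2 k).1)
              (fun k : Fin (m - n) => (I.1.orderIsoOfFin (Finset.mem_powersetCard.mp I.2).2 k).1)) *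
            Matrix.det (W.submatrix
              (fun k : Fin n => ((I.1ᶜ).orderIsoOfFin
                (by rw [Finset.card_compl, (Finset.mem_powersetCard.mp I.2).2, Fintype.card_fin]
                    omega) k).1)
              id) := by
  obtain ⟨k, hk⟩ := heven.exists_two_nsmul
  have key : ∀ (a : ℕ) (ha : a = k * 2) (hm : m = a + n) (hc : ∀ I ∈ Finset.powersetCard a
      (Finset.univ : Finset (Fin m)), I.card = a ∧ Iᶜ.card = n),
      pfaffian ((Matrix.fromBlocks Z W (-Wᵀ) 0).submatrix
        (finSumFinEquiv : Fin m ⊕ Fin n ≃ Fin (m + n)).symm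
        (finSumFinEquiv : Fin m ⊕ Fin n ≃ Fin (m + n)).symm) =
      ∑ I ∈ (Finset.powersetCard a (Finset.univ : Finset (Fin m))).attach,
        (-1 : ℝ) ^ ((∑ i ∈ I.1, ((i : ℕ) + 1)) + m * (m - 1) / 2) *
          pfaffian (Z.submatrix (I.1.orderEmbOfFin (hc I.1 I.2).1)
            (I.1.orderEmbOfFin (hc I.1 I.2).1)) *
          Matrix.det (W.submatrix (I.1ᶜ.orderEmbOfFin (hc I.1 I.2).2) id) := by
    rintro _ rfl rfl hc
    exact pfaffian_fromBlocks_eq_sum_pfaffian_mul_det Z hZ W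
  refine key (m - n) (by rw [hk, smul_eq_mul, mul_comm]) (by omega) fun I hI => ?_
  have hcard := (Finset.mem_powersetCard.mp hI).2
  refine ⟨hcard, ?_⟩
  rw [Finset.card_compl, hcard, Fintype.card_fin]
  omega
end

section
/- Let l ≥ 0, m, n be natural numbers with m − l even and m − l ≤ n. Let Z be a skew-symmetric real n×n matrix, W a real m×n matrix, and X a real m×l matrix. Then the Cauchy–Binet-type Pfaffian expansion holds: Pf [[W Z Wᵀ, X], [−Xᵀ, 0]] = (−1)^{l(l−1)/2} Σ_{I ⊆ [n], |I| = m−l} Pf Z(I) · det [ W([m]; I) | X ], where the sum runs over all (m−l)-element subsets I of [n], Z(I) is the principal submatrix of Z on I, and [ W([m]; I) | X ] is the m×m matrix formed by the columns of W indexed by I followed by the columns of X. -/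
open Matrix

open Equiv in
/-- Sum over permutations of `Fin (n + 1)`, split according to the image of `0`. -/
theorem sum_sign_mul_perm_succ {n : ℕ} (F : (Fin (n + 1) → Fin (n + 1)) → ℝ) :
    ∑ σ : Perm (Fin (n + 1)), ((Perm.sign σ : ℤ) : ℝ) * F σ =
      ∑ p : Fin (n + 1), (-1 : ℝ) ^ (p : ℕ) *
        ∑ e : Perm (Fin n), ((Perm.sign e : ℤ) : ℝ) * F (Fin.cons p (p.succAbove ∘ e)) := by
  have h1 : ∀ σ : Perm (Fin (n + 1)), ((Perm.sign σ : ℤ) : ℝ) * F σ =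
      ∑ p : Fin (n + 1), if σ 0 = p then ((Perm.sign σ : ℤ) : ℝ) * F σ else 0 := by
    intro σ
    simp
  rw [Finset.sum_congr rfl fun σ _ => h1 σ, Finset.sum_comm]
  refine Finset.sum_congr rfl fun p _ => ?_
  rw [← Equiv.sum_comp (Equiv.mulLeft (p.cycleRange⁻¹)),
    ← Equiv.sum_comp Perm.decomposeFin.symm,
    Fintype.sum_prod_type, Finset.sum_eq_single 0]
  · rw [Finset.mul_sum]
    refine Finset.sum_congr rfl fun e _ => ?_
    have hc : (⇑(p.cycleRange⁻¹ * Perm.decomposeFin.symm (0, e)) : Fin (n + 1) → Fin (n + 1)) =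
        Fin.cons p (p.succAbove ∘ e) := by
      funext x
      refine Fin.cases ?_ (fun y => ?_) x
      · simp
      · simp
    rw [Equiv.coe_mulLeft, hc]
    simp [Fin.sign_cycleRange, mul_assoc]
  · intro q _ hq
    refine Finset.sum_eq_zero fun e _ => ?_
    rw [if_neg]
    simp only [Equiv.coe_mulLeft, Perm.mul_apply, Perm.decomposeFin_symm_apply_zero]
    intro h
    apply hq
    rw [Perm.inv_eq_iff_eq] at h
    simpa using h
  · simp

theorem pfaffian_eq_of_eq_two_mul {m k : ℕ} (h : m = 2 * k) (M : Matrix (Fin m) (Fin m) ℝ) :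
    pfaffian M = ((2 : ℝ) ^ k * k.factorial)⁻¹ *
      ∑ σ : Equiv.Perm (Fin m), ((Equiv.Perm.sign σ : ℤ) : ℝ) *
        ∏ i : Fin k, M (σ ⟨2 * (i : ℕ), by have := i.isLt; omega⟩)
          (σ ⟨2 * (i : ℕ) + 1, by have := i.isLt; omega⟩) := by
  obtain rfl : k = m / 2 := by omega
  rfl

open Equiv in
/-- The summand of the Pfaffian is invariant under a transposition inside a pair of positions. -/
theorem pfaffian_term_mul_swap {m k : ℕ} (h : m = 2 * k) {M : Matrix (Fin m) (Fin m) ℝ}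
    (hM : Mᵀ = -M) (i : Fin k) {s : Perm (Fin m)}
    (hs : s = Equiv.swap ⟨2 * (i : ℕ), by omega⟩ ⟨2 * (i : ℕ) + 1, by omega⟩)
    (σ : Perm (Fin m)) :
    ((Perm.sign (σ * s) : ℤ) : ℝ) *
        ∏ j : Fin k, M ((σ * s) ⟨2 * (j : ℕ), by omega⟩) ((σ * s) ⟨2 * (j : ℕ) + 1, by omega⟩) =
      ((Perm.sign σ : ℤ) : ℝ) *
        ∏ j : Fin k, M (σ ⟨2 * (j : ℕ), by omega⟩) (σ ⟨2 * (j : ℕ) + 1, by omega⟩) := by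
  have hskew : ∀ a b, M a b = -M b a := fun a b => by
    have := congrFun (congrFun hM b) a
    simpa using this
  have hfac : ∀ j : Fin k,
      M ((σ * s) ⟨2 * (j : ℕ), by omega⟩) ((σ * s) ⟨2 * (j : ℕ) + 1, by omega⟩) =
        (if i = j then -1 else 1) *
          M (σ ⟨2 * (j : ℕ), by omega⟩) (σ ⟨2 * (j : ℕ) + 1, by omega⟩) := by
    intro j
    by_cases hij : i = j
    · subst hij
      rw [hs, Perm.mul_apply, Perm.mul_apply, swap_apply_left, swap_apply_right, hskew,
        if_pos rfl, neg_one_mul]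
    · have hij' : (i : ℕ) ≠ j := fun h => hij (Fin.ext h)
      rw [hs, Perm.mul_apply, Perm.mul_apply, swap_apply_of_ne_of_ne, swap_apply_of_ne_of_ne,
        if_neg hij, one_mul] <;> simp only [ne_eq, Fin.mk.injEq] <;> omega
  rw [Finset.prod_congr rfl fun j _ => hfac j, Finset.prod_mul_distrib, Finset.prod_ite_eq,
    Perm.sign_mul, hs, Perm.sign_swap (by simp)]
  simp

open Equiv in
/-- Two pairs of positions can be exchanged without changing the summand of the Pfaffian. -/
theorem exists_perm_pfaffian_term_mul {m k : ℕ} (h : m = 2 * k)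
    (M : Matrix (Fin m) (Fin m) ℝ) (i₀ i : Fin k) :
    ∃ ρ : Perm (Fin m), ρ ⟨2 * (i₀ : ℕ), by omega⟩ = ⟨2 * (i : ℕ), by omega⟩ ∧
      ∀ σ : Perm (Fin m), ((Perm.sign (σ * ρ) : ℤ) : ℝ) *
        ∏ j : Fin k, M ((σ * ρ) ⟨2 * (j : ℕ), by omega⟩) ((σ * ρ) ⟨2 * (j : ℕ) + 1, by omega⟩) =
      ((Perm.sign σ : ℤ) : ℝ) *
        ∏ j : Fin k, M (σ ⟨2 * (j : ℕ), by omega⟩) (σ ⟨2 * (j : ℕ) + 1, by omega⟩) := by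
  by_cases hi : i₀ = i
  · subst hi
    exact ⟨1, rfl, fun σ => by simp⟩
  have hi' : (i₀ : ℕ) ≠ i := fun h => hi (Fin.ext h)
  let ρ : Perm (Fin m) := Equiv.swap ⟨2 * (i₀ : ℕ), by omega⟩ ⟨2 * (i : ℕ), by omega⟩ *
    Equiv.swap ⟨2 * (i₀ : ℕ) + 1, by omega⟩ ⟨2 * (i : ℕ) + 1, by omega⟩
  have hρ0 : ∀ j : Fin k, ρ ⟨2 * (j : ℕ), by omega⟩ = ⟨2 * (Equiv.swap i₀ i j : Fin k), by omega⟩ := by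
    intro j
    simp only [ρ, Perm.mul_apply, swap_apply_def, Fin.ext_iff]
    split_ifs <;> simp_all <;> omega
  have hρ1 : ∀ j : Fin k,
      ρ ⟨2 * (j : ℕ) + 1, by omega⟩ = ⟨2 * (Equiv.swap i₀ i j : Fin k) + 1, by omega⟩ := by
    intro j
    simp only [ρ, Perm.mul_apply, swap_apply_def, Fin.ext_iff]
    split_ifs <;> simp_all <;> omega
  refine ⟨ρ, by rw [hρ0]; simp, fun σ => ?_⟩
  have hsign : Perm.sign (σ * ρ) = Perm.sign σ := by
    rw [Perm.sign_mul, Perm.sign_mul, Perm.sign_swap, Perm.sign_swap]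
    · simp
    · simp only [ne_eq, Fin.mk.injEq]; omega
    · simp only [ne_eq, Fin.mk.injEq]; omega
  rw [hsign]
  congr 1
  simp only [Perm.mul_apply, hρ0, hρ1]
  exact Equiv.prod_comp (Equiv.swap i₀ i)
    fun j : Fin k => M (σ ⟨2 * (j : ℕ), by omega⟩) (σ ⟨2 * (j : ℕ) + 1, by omega⟩)

open Equiv in
/-- Expansion of the Pfaffian along the last column. -/
theorem pfaffian_succ_succ {N : ℕ} (hN : Even N) {M : Matrix (Fin (N + 2)) (Fin (N + 2)) ℝ}
    (hM : Mᵀ = -M) :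
    pfaffian M = ∑ j : Fin (N + 1), (-1 : ℝ) ^ (j + N : ℕ) * M j.castSucc (Fin.last _) *
      pfaffian (M.submatrix (fun x => (j.succAbove x).castSucc)
        (fun x => (j.succAbove x).castSucc)) := by
  obtain ⟨k, hk⟩ := hN.two_dvd
  have h2 : N + 2 = 2 * (k + 1) := by omega
  have hskew : ∀ a b, M a b = -M b a := fun a b => by
    have := congrFun (congrFun hM b) a
    simpa using this
  simp_rw [pfaffian_eq_of_eq_two_mul hk]
  rw [pfaffian_eq_of_eq_two_mul h2]
  set w : Perm (Fin (N + 2)) → ℝ := fun σ => ((Perm.sign σ : ℤ) : ℝ) *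
    ∏ j : Fin (k + 1), M (σ ⟨2 * (j : ℕ), by omega⟩) (σ ⟨2 * (j : ℕ) + 1, by omega⟩) with hw
  have hpos : ∀ q : Fin (N + 2), ∃ ρ : Perm (Fin (N + 2)), ρ 0 = q ∧ ∀ σ, w (σ * ρ) = w σ := by
    intro q
    obtain ⟨ρ, hρ, hρw⟩ := exists_perm_pfaffian_term_mul h2 M 0 ⟨(q : ℕ) / 2, by omega⟩
    have hρ' : ρ 0 = ⟨2 * ((q : ℕ) / 2), by omega⟩ := hρ
    rcases Nat.mod_two_eq_zero_or_one (q : ℕ) with hq | hq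
    · exact ⟨ρ, by rw [hρ', Fin.ext_iff]; simp only; omega, hρw⟩
    · refine ⟨Equiv.swap ⟨2 * ((q : ℕ) / 2), by omega⟩ ⟨2 * ((q : ℕ) / 2) + 1, by omega⟩ * ρ, ?_, ?_⟩
      · rw [Perm.mul_apply, hρ', swap_apply_left, Fin.ext_iff]
        simp only
        omega
      · intro σ
        rw [← mul_assoc]
        exact (hρw _).trans (pfaffian_term_mul_swap h2 hM ⟨(q : ℕ) / 2, by omega⟩ rfl σ)
  have hsum : ∑ σ, w σ =
      (N + 2 : ℝ) * ∑ σ : Perm (Fin (N + 2)), if σ 0 = Fin.last _ then w σ else 0 := by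
    have h1 : ∀ σ : Perm (Fin (N + 2)),
        w σ = ∑ q : Fin (N + 2), if σ q = Fin.last _ then w σ else 0 := by
      intro σ
      have : ∀ q, σ q = Fin.last _ ↔ q = σ⁻¹ (Fin.last _) := fun q => by
        rw [Perm.eq_inv_iff_eq]
      simp [this]
    rw [Finset.sum_congr rfl fun σ _ => h1 σ, Finset.sum_comm]
    have h3 : ∀ q : Fin (N + 2), (∑ σ : Perm (Fin (N + 2)), if σ q = Fin.last _ then w σ else 0) =
        ∑ σ : Perm (Fin (N + 2)), if σ 0 = Fin.last _ then w σ else 0 := by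
      intro q
      obtain ⟨ρ, hρ, hρw⟩ := hpos q
      rw [← Equiv.sum_comp (Equiv.mulRight ρ) fun σ : Perm (Fin (N + 2)) =>
        if σ 0 = Fin.last _ then w σ else 0]
      simp [hρ, hρw]
    rw [Finset.sum_congr rfl fun q _ => h3 q]
    simp
  have hfirst : (∑ σ : Perm (Fin (N + 2)), if σ 0 = Fin.last _ then w σ else 0) =
      ∑ j : Fin (N + 1), (-1 : ℝ) ^ (j + N : ℕ) * M j.castSucc (Fin.last _) *
        ∑ τ : Perm (Fin N), ((Perm.sign τ : ℤ) : ℝ) *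
          ∏ i : Fin k, M (j.succAbove (τ ⟨2 * (i : ℕ), by omega⟩)).castSucc
            (j.succAbove (τ ⟨2 * (i : ℕ) + 1, by omega⟩)).castSucc := by
    have h1 := sum_sign_mul_perm_succ fun f : Fin (N + 2) → Fin (N + 2) =>
      if f 0 = Fin.last _ then
        ∏ j : Fin (k + 1), M (f ⟨2 * (j : ℕ), by omega⟩) (f ⟨2 * (j : ℕ) + 1, by omega⟩) else 0
    have h3 := sum_sign_mul_perm_succ fun f : Fin (N + 1) → Fin (N + 1) =>
      M (Fin.last _) (f 0).castSucc *
        ∏ j : Fin k, M (f ⟨2 * (j : ℕ) + 1, by omega⟩).castSucc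
          (f ⟨2 * (j : ℕ) + 2, by omega⟩).castSucc
    simp only [mul_ite, mul_zero] at h1
    refine h1.trans ?_
    rw [Finset.sum_eq_single (Fin.last _)]
    · simp only [Fin.cons_zero, if_true, Fin.prod_univ_succ, Fin.succAbove_last]
      have h4 : ∀ e : Perm (Fin (N + 1)),
          (M ((Fin.cons (Fin.last (N + 1)) (Fin.castSucc ∘ e) : Fin (N + 2) → Fin (N + 2))
              ⟨2 * ((0 : Fin (k + 1)) : ℕ), by simp⟩)
            ((Fin.cons (Fin.last (N + 1)) (Fin.castSucc ∘ e) : Fin (N + 2) → Fin (N + 2))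
              ⟨2 * ((0 : Fin (k + 1)) : ℕ) + 1, by simp⟩)) =
            M (Fin.last _) (e 0).castSucc := fun e => rfl
      have h5 : ∀ (e : Perm (Fin (N + 1))) (i : Fin k),
          (M ((Fin.cons (Fin.last (N + 1)) (Fin.castSucc ∘ e) : Fin (N + 2) → Fin (N + 2))
              ⟨2 * (i.succ : ℕ), by simp; omega⟩)
            ((Fin.cons (Fin.last (N + 1)) (Fin.castSucc ∘ e) : Fin (N + 2) → Fin (N + 2))
              ⟨2 * (i.succ : ℕ) + 1, by simp; omega⟩)) =
            M (e ⟨2 * (i : ℕ) + 1, by omega⟩).castSucc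
              (e ⟨2 * (i : ℕ) + 2, by omega⟩).castSucc := fun e i => rfl
      simp only [h4, h5]
      rw [h3, Finset.mul_sum]
      refine Finset.sum_congr rfl fun j _ => ?_
      have h6 : ∀ (e : Perm (Fin N)),
          (Fin.cons j (j.succAbove ∘ e) : Fin (N + 1) → Fin (N + 1)) 0 = j := fun e => rfl
      have h7 : ∀ (e : Perm (Fin N)) (i : Fin k),
          (Fin.cons j (j.succAbove ∘ e) : Fin (N + 1) → Fin (N + 1)) ⟨2 * (i : ℕ) + 1, by omega⟩ =
            j.succAbove (e ⟨2 * (i : ℕ), by omega⟩) := fun e i => rfl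
      have h8 : ∀ (e : Perm (Fin N)) (i : Fin k),
          (Fin.cons j (j.succAbove ∘ e) : Fin (N + 1) → Fin (N + 1)) ⟨2 * (i : ℕ) + 2, by omega⟩ =
            j.succAbove (e ⟨2 * (i : ℕ) + 1, by omega⟩) := fun e i => rfl
      simp only [h6, h7, h8]
      rw [hskew (Fin.last _), Finset.mul_sum, Finset.mul_sum, Finset.mul_sum]
      refine Finset.sum_congr rfl fun τ _ => ?_
      rw [Fin.val_last]
      ring
    · intro q _ hq
      simp [hq]
    · simp
  rw [hsum, hfirst, Finset.mul_sum, Finset.mul_sum]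
  refine Finset.sum_congr rfl fun j _ => ?_
  have hfact : ((2 : ℝ) ^ (k + 1) * ((k + 1).factorial : ℝ))⁻¹ * (N + 2 : ℝ) =
      ((2 : ℝ) ^ k * (k.factorial : ℝ))⁻¹ := by
    rw [hk, Nat.factorial_succ]
    have : (k.factorial : ℝ) ≠ 0 := by positivity
    push_cast
    field_simp
    ring
  simp only [Matrix.submatrix_apply]
  rw [← mul_assoc, hfact]
  ring

/-- A product over `Fin (2 * k)` grouped into consecutive pairs. -/
theorem prod_fin_two_mul {m k : ℕ} (h : m = 2 * k) (f : Fin m → ℝ) :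
    ∏ j, f j = ∏ i : Fin k, f ⟨2 * (i : ℕ), by omega⟩ * f ⟨2 * (i : ℕ) + 1, by omega⟩ := by
  subst h
  induction k with
  | zero => simp
  | succ k ih =>
    rw [Fin.prod_univ_castSucc (n := k)]
    exact (Fin.prod_univ_castSucc (n := 2 * k + 1) f).trans <|
      (congrArg (· * f (Fin.last (2 * k + 1))) <|
        (Fin.prod_univ_castSucc (n := 2 * k) fun j => f j.castSucc).trans <|
          congrArg (· * f (Fin.last (2 * k)).castSucc) (ih fun j => f j.castSucc.castSucc)).trans
      (mul_assoc _ _ _)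

/-- Functions on `Fin (2 * k)` are `k`-tuples of pairs. -/
def finTwoMulArrowEquiv (α : Type*) {m k : ℕ} (h : m = 2 * k) :
    (Fin m → α) ≃ (Fin k → α × α) where
  toFun f i := (f ⟨2 * (i : ℕ), by omega⟩, f ⟨2 * (i : ℕ) + 1, by omega⟩)
  invFun g j := if (j : ℕ) % 2 = 0 then (g ⟨(j : ℕ) / 2, by omega⟩).1
    else (g ⟨(j : ℕ) / 2, by omega⟩).2
  left_inv f := by
    funext j
    simp only
    split_ifs with hj
    · congr 1
      ext
      simp only
      omega
    · congr 1
      ext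
      simp only
      omega
  right_inv g := by
    funext i
    have h1 : (2 * (i : ℕ)) / 2 = i := by omega
    have h2 : (2 * (i : ℕ) + 1) / 2 = i := by omega
    have h3 : (2 * (i : ℕ) + 1) % 2 = 1 := by omega
    simp [h1, h2, h3]

open Equiv in
/-- A sum over all column selections of a multiple of the corresponding minor reduces to a sum
over increasing selections. -/
theorem sum_mul_det_submatrix {m n : ℕ} (W : Matrix (Fin m) (Fin n) ℝ)
    (G : (Fin m → Fin n) → ℝ) :
    ∑ f : Fin m → Fin n, G f * (W.submatrix id f).det =
      ∑ I ∈ (Finset.powersetCard m (Finset.univ : Finset (Fin n))).attach,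
        (∑ τ : Perm (Fin m), ((Perm.sign τ : ℤ) : ℝ) *
          G fun k => (I.1.orderIsoOfFin (Finset.mem_powersetCard.mp I.2).2 (τ k)).1) *
        (W.submatrix id
          fun k => (I.1.orderIsoOfFin (Finset.mem_powersetCard.mp I.2).2 k).1).det := by
  have hinj : ∀ f : Fin m → Fin n, ¬ Function.Injective f → (W.submatrix id f).det = 0 := by
    intro f hf
    simp only [Function.Injective, not_forall] at hf
    obtain ⟨a, b, hab, hne⟩ := hf
    exact Matrix.det_zero_of_column_eq hne fun k => by simp [hab]
  have hcard : ∀ f ∈ Finset.univ.filter fun f : Fin m → Fin n => Function.Injective f,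
      Finset.univ.image f ∈ Finset.powersetCard m (Finset.univ : Finset (Fin n)) := by
    intro f hf
    rw [Finset.mem_powersetCard]
    refine ⟨Finset.subset_univ _, ?_⟩
    rw [Finset.card_image_of_injective _ (Finset.mem_filter.mp hf).2]
    simp
  rw [← Finset.sum_filter_of_ne (p := fun f : Fin m → Fin n => Function.Injective f)
    (fun f _ hf => by
      by_contra h
      exact hf (by rw [hinj f h, mul_zero])),
    ← Finset.sum_fiberwise_of_maps_to hcard, ← Finset.sum_attach]
  refine Finset.sum_congr rfl fun I _ => ?_
  have hI := (Finset.mem_powersetCard.mp I.2).2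
  rw [Finset.sum_mul]
  symm
  refine Finset.sum_bij (fun τ _ => fun k => (I.1.orderIsoOfFin hI (τ k)).1) ?_ ?_ ?_ ?_
  · intro τ _
    have hτ : Function.Injective fun k => (I.1.orderIsoOfFin hI (τ k)).1 :=
      Subtype.val_injective.comp ((I.1.orderIsoOfFin hI).injective.comp τ.injective)
    simp only [Finset.mem_filter, Finset.mem_univ, true_and]
    refine ⟨hτ, Finset.eq_of_subset_of_card_le ?_ ?_⟩
    · intro x hx
      obtain ⟨k, -, rfl⟩ := Finset.mem_image.mp hx
      exact (I.1.orderIsoOfFin hI (τ k)).2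
    · rw [Finset.card_image_of_injective _ hτ, hI]
      simp
  · intro τ _ τ' _ h
    ext k : 1
    exact (I.1.orderIsoOfFin hI).injective (Subtype.val_injective (congrFun h k))
  · intro f hf
    simp only [Finset.mem_filter, Finset.mem_univ, true_and] at hf
    obtain ⟨hf, hfI⟩ := hf
    have hmem : ∀ k, f k ∈ I.1 := fun k => hfI ▸ Finset.mem_image_of_mem f (Finset.mem_univ k)
    have hτ : Function.Injective fun k => (I.1.orderIsoOfFin hI).symm ⟨f k, hmem k⟩ := by
      intro a b hab
      exact hf (by simpa using hab)
    refine ⟨Equiv.ofBijective _ (Finite.injective_iff_bijective.mp hτ), Finset.mem_univ _, ?_⟩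
    funext k
    simp
  · intro τ _
    have := Matrix.det_permute' τ
      (W.submatrix id fun k => (I.1.orderIsoOfFin hI k).1)
    rw [Matrix.submatrix_submatrix] at this
    change _ = _ * (W.submatrix (id ∘ id) ((fun k => (I.1.orderIsoOfFin hI k).1) ∘ τ)).det
    rw [this]
    ring

open Equiv in
/-- The minor summation formula for Pfaffians. -/
theorem pfaffian_mul_mul_transpose {m n : ℕ} (hm : Even m) (Z : Matrix (Fin n) (Fin n) ℝ)
    (W : Matrix (Fin m) (Fin n) ℝ) :
    pfaffian (W * Z * Wᵀ) =
      ∑ I ∈ (Finset.powersetCard m (Finset.univ : Finset (Fin n))).attach,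
        pfaffian (Z.submatrix
          (fun k => (I.1.orderIsoOfFin (Finset.mem_powersetCard.mp I.2).2 k).1)
          (fun k => (I.1.orderIsoOfFin (Finset.mem_powersetCard.mp I.2).2 k).1)) *
        (W.submatrix id
          fun k => (I.1.orderIsoOfFin (Finset.mem_powersetCard.mp I.2).2 k).1).det := by
  obtain ⟨k, hk⟩ := hm.two_dvd
  simp_rw [pfaffian_eq_of_eq_two_mul hk, mul_assoc (_⁻¹ : ℝ)]
  rw [← Finset.mul_sum]
  congr 1
  have h1 := sum_mul_det_submatrix W fun f : Fin m → Fin n =>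
    ∏ i : Fin k, Z (f ⟨2 * (i : ℕ), by omega⟩) (f ⟨2 * (i : ℕ) + 1, by omega⟩)
  refine Eq.trans ?_ h1
  simp_rw [Matrix.det_apply', Finset.mul_sum]
  rw [Finset.sum_comm]
  refine Finset.sum_congr rfl fun σ _ => ?_
  have h2 : ∀ a b, (W * Z * Wᵀ) a b = ∑ p : Fin n × Fin n, Z p.1 p.2 * (W a p.1 * W b p.2) := by
    intro a b
    rw [Matrix.mul_assoc]
    simp only [Matrix.mul_apply, Fintype.sum_prod_type, Matrix.transpose_apply,
      Finset.mul_sum]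
    refine Finset.sum_congr rfl fun c _ => Finset.sum_congr rfl fun d _ => ?_
    ring
  simp_rw [h2]
  rw [Fintype.prod_sum, ← (finTwoMulArrowEquiv (Fin n) hk).sum_comp, Finset.mul_sum]
  refine Finset.sum_congr rfl fun f _ => ?_
  rw [Finset.prod_mul_distrib, prod_fin_two_mul hk]
  simp only [finTwoMulArrowEquiv, Equiv.coe_fn_mk, Matrix.submatrix_apply, id_eq]
  ring

/-- Coordinates of `Fin (m + l)` in the block decomposition `Fin m ⊕ Fin l`, compatibly with
casts of the total size. -/
def blockIndex {m l N : ℕ} (h : m + l = N) (x : Fin N) : Fin m ⊕ Fin l :=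
  finSumFinEquiv.symm (Fin.cast h.symm x)

theorem blockIndex_of_lt {m l N : ℕ} (h : m + l = N) (x : Fin N) (hx : (x : ℕ) < m) :
    blockIndex h x = Sum.inl ⟨x, hx⟩ := by
  rw [blockIndex, Equiv.symm_apply_eq]
  ext
  simp

theorem blockIndex_of_le {m l N : ℕ} (h : m + l = N) (x : Fin N) (hx : m ≤ (x : ℕ)) :
    blockIndex h x = Sum.inr ⟨x - m, by omega⟩ := by
  rw [blockIndex, Equiv.symm_apply_eq]
  ext
  simp [hx]

theorem blockIndex_castSucc_succAbove {m l N : ℕ} (h : m + l = N)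
    (h' : m + 1 + (l + 1) = N + 2) (j : Fin (N + 1)) (hj : (j : ℕ) < m + 1) (x : Fin N) :
    blockIndex h' (j.succAbove x).castSucc =
      Sum.map (Fin.succAbove ⟨j, hj⟩) Fin.castSucc (blockIndex h x) := by
  rcases lt_or_ge (x : ℕ) m with hx | hx
  · have hx' : ((j.succAbove x).castSucc : ℕ) < m + 1 := by
      simp only [Fin.val_castSucc, Fin.succAbove, Fin.lt_def]
      split_ifs <;> simp <;> omega
    rw [blockIndex_of_lt _ _ hx', blockIndex_of_lt _ _ hx]
    simp only [Sum.map_inl, Sum.inl.injEq, Fin.ext_iff, Fin.succAbove, Fin.lt_def,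
      Fin.val_castSucc]
    split_ifs <;> simp
  · have hx' : ((j.succAbove x).castSucc : ℕ) = x + 1 := by
      rw [Fin.val_castSucc, Fin.succAbove_of_le_castSucc]
      · simp
      · simp only [Fin.le_def, Fin.val_castSucc]
        omega
    rw [blockIndex_of_le _ _ (by omega), blockIndex_of_le _ _ hx]
    simp only [Sum.map_inr, Sum.inr.injEq, Fin.ext_iff, Fin.val_castSucc]
    rw [Fin.val_castSucc] at hx'
    omega

theorem neg_one_pow_mul_pred_div_two_succ (l : ℕ) :
    (-1 : ℝ) ^ ((l + 1) * (l + 1 - 1) / 2) = (-1) ^ l * (-1) ^ (l * (l - 1) / 2) := by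
  rw [← pow_add]
  congr 1
  rw [← Finset.sum_range_id_mul_two, ← Finset.sum_range_id_mul_two, Finset.sum_range_succ]
  omega

/-- The block form of the expansion, with the size of the index sets `I` as a parameter. -/
theorem pfaffian_fromBlocks_blockIndex {n r : ℕ} (hr : Even r) {Z : Matrix (Fin n) (Fin n) ℝ}
    (hZ : Zᵀ = -Z) (l : ℕ) :
    ∀ (m N : ℕ) (hm : r + l = m) (h : m + l = N) (W : Matrix (Fin m) (Fin n) ℝ)
      (X : Matrix (Fin m) (Fin l) ℝ),
    pfaffian ((Matrix.fromBlocks (W * Z * Wᵀ) X (-Xᵀ) 0).submatrix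
        (blockIndex h) (blockIndex h)) =
      (-1 : ℝ) ^ (l * (l - 1) / 2) *
        ∑ I ∈ (Finset.powersetCard r (Finset.univ : Finset (Fin n))).attach,
          pfaffian (Z.submatrix
            (fun k : Fin r => (I.1.orderIsoOfFin (Finset.mem_powersetCard.mp I.2).2 k).1)
            (fun k : Fin r => (I.1.orderIsoOfFin (Finset.mem_powersetCard.mp I.2).2 k).1)) *
          Matrix.det (Matrix.of fun (i : Fin m) (j : Fin m) =>
            if h : (j : ℕ) < r then
              W i (I.1.orderIsoOfFin (Finset.mem_powersetCard.mp I.2).2 ⟨j, h⟩).1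
            else
              X i ⟨(j : ℕ) - r, by have := j.isLt; omega⟩) := by
  induction l with
  | zero =>
    intro m N hm h W X
    obtain rfl : r = m := hm
    obtain rfl : r = N := h
    have hblock : (Matrix.fromBlocks (W * Z * Wᵀ) X (-Xᵀ) 0).submatrix
        (blockIndex (rfl : r + 0 = r)) (blockIndex (rfl : r + 0 = r)) = W * Z * Wᵀ := by
      ext a b
      rw [Matrix.submatrix_apply, blockIndex_of_lt _ a a.isLt, blockIndex_of_lt _ b b.isLt]
      rfl
    rw [hblock, pfaffian_mul_mul_transpose hr]
    simp only [zero_mul, Nat.zero_div, pow_zero, one_mul]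
    refine Finset.sum_congr rfl fun I _ => ?_
    congr 2
    ext a b
    simp
  | succ l ih =>
    intro m N hm h W X
    obtain ⟨m, rfl⟩ : ∃ m', m = m' + 1 := ⟨r + l, by omega⟩
    obtain ⟨N, rfl⟩ : ∃ N', N = N' + 2 := ⟨m + l, by omega⟩
    have hm' : r + l = m := by omega
    have h' : m + l = N := by omega
    have hN : Even N := by
      rw [← h', ← hm', add_assoc]
      exact hr.add (Even.add_self l)
    have hA : (W * Z * Wᵀ)ᵀ = -(W * Z * Wᵀ) := by
      simp [Matrix.transpose_mul, hZ, Matrix.mul_assoc]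
    have hskew : ((Matrix.fromBlocks (W * Z * Wᵀ) X (-Xᵀ) 0).submatrix
        (blockIndex h) (blockIndex h))ᵀ = -(Matrix.fromBlocks (W * Z * Wᵀ) X (-Xᵀ) 0).submatrix
        (blockIndex h) (blockIndex h) := by
      rw [Matrix.transpose_submatrix, Matrix.fromBlocks_transpose, hA]
      change _ = (-Matrix.fromBlocks (W * Z * Wᵀ) X (-Xᵀ) 0).submatrix _ _
      rw [Matrix.fromBlocks_neg]
      simp
    have hlast : blockIndex h (Fin.last (N + 1)) = Sum.inr (Fin.last l) := by
      rw [blockIndex_of_le h _ (by simp; omega)]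
      simp only [Sum.inr.injEq, Fin.ext_iff, Fin.val_last]
      omega
    rw [pfaffian_succ_succ hN hskew, neg_one_pow_mul_pred_div_two_succ]
    have hcast : m + 1 + l = N + 1 := by omega
    rw [← (finCongr hcast).sum_comp, Fin.sum_univ_add, Finset.sum_eq_zero (s := Finset.univ)
      (f := fun i : Fin l => _) ?_, add_zero]
    · have hterm : ∀ j : Fin (m + 1),
          (-1 : ℝ) ^ ((finCongr hcast (Fin.castAdd l j) : ℕ) + N) *
            (Matrix.fromBlocks (W * Z * Wᵀ) X (-Xᵀ) 0).submatrix (blockIndex h) (blockIndex h)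
              (finCongr hcast (Fin.castAdd l j)).castSucc (Fin.last (N + 1)) *
            pfaffian (((Matrix.fromBlocks (W * Z * Wᵀ) X (-Xᵀ) 0).submatrix
              (blockIndex h) (blockIndex h)).submatrix
                (fun x => ((finCongr hcast (Fin.castAdd l j)).succAbove x).castSucc)
                (fun x => ((finCongr hcast (Fin.castAdd l j)).succAbove x).castSucc)) =
          (-1 : ℝ) ^ ((j : ℕ) + N) * X j (Fin.last l) *
            pfaffian ((Matrix.fromBlocks
              (W.submatrix j.succAbove id * Z * (W.submatrix j.succAbove id)ᵀ)
              (X.submatrix j.succAbove Fin.castSucc)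
              (-(X.submatrix j.succAbove Fin.castSucc)ᵀ) 0).submatrix
                (blockIndex h') (blockIndex h')) := by
        intro j
        have hj : ((finCongr hcast (Fin.castAdd l j) : Fin (N + 1)) : ℕ) < m + 1 := by simp; omega
        congr 2
        · rw [Matrix.submatrix_apply, hlast, blockIndex_of_lt h _ (by simp; omega)]
          rfl
        · ext x y
          simp only [Matrix.submatrix_apply]
          rw [blockIndex_castSucc_succAbove h' h _ hj, blockIndex_castSucc_succAbove h' h _ hj]
          rcases blockIndex h' x with a | a <;> rcases blockIndex h' y with b | b <;> rfl
      rw [Finset.sum_congr rfl fun j _ => hterm j]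
      simp_rw [ih m N hm' h', Finset.mul_sum]
      rw [Finset.sum_comm]
      refine Finset.sum_congr rfl fun I _ => ?_
      rw [Matrix.det_succ_column _ (Fin.last m), Finset.mul_sum, Finset.mul_sum]
      refine Finset.sum_congr rfl fun j _ => ?_
      have hentry : ∀ hlt : m - r < l + 1, (⟨m - r, hlt⟩ : Fin (l + 1)) = Fin.last l := by
        intro hlt
        ext
        simp only [Fin.val_last]
        omega
      have hsign : (-1 : ℝ) ^ ((j : ℕ) + N) = (-1) ^ l * (-1) ^ ((j : ℕ) + m) := by
        rw [← pow_add]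
        congr 1
        omega
      have hminor : (Matrix.of fun (i : Fin m) (k : Fin m) =>
            if h : (k : ℕ) < r then
              (W.submatrix j.succAbove id) i
                (I.1.orderIsoOfFin (Finset.mem_powersetCard.mp I.2).2 ⟨k, h⟩).1
            else
              (X.submatrix j.succAbove Fin.castSucc) i
                ⟨(k : ℕ) - r, by have := k.isLt; omega⟩) =
          (Matrix.of fun (i : Fin (m + 1)) (k : Fin (m + 1)) =>
            if h : (k : ℕ) < r then
              W i (I.1.orderIsoOfFin (Finset.mem_powersetCard.mp I.2).2 ⟨k, h⟩).1
            else
              X i ⟨(k : ℕ) - r, by have := k.isLt; omega⟩).submatrix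
                j.succAbove (Fin.last m).succAbove := by
        ext a b
        simp
      rw [hminor, hsign, Matrix.of_apply, dif_neg (by simp; omega)]
      simp only [Fin.val_last, hentry]
      ring
    · intro i _
      rw [Matrix.submatrix_apply, hlast, blockIndex_of_le h _ (by simp)]
      simp

/-- **Cauchy–Binet-type expansion of the Pfaffian** (Ishikawa–Wakayama, Okada).
For `l ≤ m`, `m - l` even, `m - l ≤ n`, `Z` skew-symmetric `n × n`, `W` an `m × n`
matrix, and `X` an `m × l` matrix:
`Pf [[W Z Wᵀ, X], [-Xᵀ, 0]] = (-1)^{l(l-1)/2} Σ_{I ⊆ [n], |I| = m-l} Pf Z(I) · det [W([m];I) | X]`. -/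
theorem stmt_7 (l m n : ℕ) (hlm : l ≤ m) (heven : Even (m - l)) (hmln : m - l ≤ n)
    (Z : Matrix (Fin n) (Fin n) ℝ) (hZ : Zᵀ = -Z)
    (W : Matrix (Fin m) (Fin n) ℝ) (X : Matrix (Fin m) (Fin l) ℝ) :
    pfaffian ((Matrix.fromBlocks (W * Z * Wᵀ) X (-Xᵀ) 0).submatrix
        (finSumFinEquiv : Fin m ⊕ Fin l ≃ Fin (m + l)).symm
        (finSumFinEquiv : Fin m ⊕ Fin l ≃ Fin (m + l)).symm)
      = (-1 : ℝ) ^ (l * (l - 1) / 2) *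
          ∑ I ∈ (Finset.powersetCard (m - l) (Finset.univ : Finset (Fin n))).attach,
            pfaffian (Z.submatrix
              (fun k : Fin (m - l) => (I.1.orderIsoOfFin (Finset.mem_powersetCard.mp I.2).2 k).1)
              (fun k : Fin (m - l) => (I.1.orderIsoOfFin (Finset.mem_powersetCard.mp I.2).2 k).1)) *
            Matrix.det (Matrix.of fun (i : Fin m) (j : Fin m) =>
              if h : (j : ℕ) < m - l then
                W i (I.1.orderIsoOfFin (Finset.mem_powersetCard.mp I.2).2 ⟨j, h⟩).1
              else
                X i ⟨(j : ℕ) - (m - l), by have := j.isLt; omega⟩) := by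
  exact pfaffian_fromBlocks_blockIndex heven hZ l m (m + l) (Nat.sub_add_cancel hlm) rfl W X
end

section
/- Let n be an even natural number, Z a skew-symmetric real n×n matrix, and W a real n×n matrix. Then Pf( W Z Wᵀ ) = Pf Z · det W. -/
open Matrix

/-- The product of the values `v (2i) ⬝ Z v (2i+1)` is linear in each of the vectors `v j`. -/
theorem exists_linearMap_prod_dotProduct_update {n : ℕ} (hn : Even n)
    (Z : Matrix (Fin n) (Fin n) ℝ) (v : Fin n → Fin n → ℝ) (j : Fin n) :
    ∃ φ : (Fin n → ℝ) →ₗ[ℝ] ℝ, ∀ z, ∏ i : Fin (n / 2),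
      Function.update v j z ⟨2 * (i : ℕ), by have := i.isLt; omega⟩ ⬝ᵥ
        Z *ᵥ Function.update v j z ⟨2 * (i : ℕ) + 1, by have := i.isLt; omega⟩ = φ z := by
  obtain ⟨k, hk⟩ := hn
  have hj : (j : ℕ) / 2 < n / 2 := by have := j.isLt; omega
  set c := ∏ i ∈ Finset.univ.erase (⟨(j : ℕ) / 2, hj⟩ : Fin (n / 2)),
    v ⟨2 * (i : ℕ), by have := i.isLt; omega⟩ ⬝ᵥ
      Z *ᵥ v ⟨2 * (i : ℕ) + 1, by have := i.isLt; omega⟩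
  have hc : ∀ z, ∏ i ∈ Finset.univ.erase (⟨(j : ℕ) / 2, hj⟩ : Fin (n / 2)),
      Function.update v j z ⟨2 * (i : ℕ), by have := i.isLt; omega⟩ ⬝ᵥ
        Z *ᵥ Function.update v j z ⟨2 * (i : ℕ) + 1, by have := i.isLt; omega⟩ = c := by
    refine fun z => Finset.prod_congr rfl fun i hi => ?_
    have hne : (i : ℕ) ≠ j / 2 := fun h => Finset.ne_of_mem_erase hi (Fin.ext h)
    rw [Function.update_of_ne, Function.update_of_ne] <;>
      · rw [Ne, Fin.ext_iff]
        dsimp only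
        omega
  simp only [← Finset.mul_prod_erase _ _ (Finset.mem_univ (⟨(j : ℕ) / 2, hj⟩ : Fin (n / 2))), hc]
  simp only [Function.update_apply, Fin.ext_iff]
  rcases Nat.mod_two_eq_zero_or_one j with h | h
  · have h₀ : 2 * ((j : ℕ) / 2) = j := by omega
    have h₁ : 2 * ((j : ℕ) / 2) + 1 ≠ j := by omega
    simp only [if_pos h₀, if_neg h₁]
    exact ⟨{ toFun := fun z => z ⬝ᵥ Z *ᵥ v ⟨2 * ((j : ℕ) / 2) + 1, by omega⟩ * c
             map_add' := fun x y => by rw [add_dotProduct, add_mul]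
             map_smul' := fun a x => by
              simp only [smul_dotProduct, smul_eq_mul, mul_assoc, RingHom.id_apply] },
      fun _ => rfl⟩
  · have h₀ : 2 * ((j : ℕ) / 2) ≠ j := by omega
    have h₁ : 2 * ((j : ℕ) / 2) + 1 = j := by omega
    simp only [if_neg h₀, if_pos h₁]
    exact ⟨{ toFun := fun z => v ⟨2 * ((j : ℕ) / 2), by omega⟩ ⬝ᵥ Z *ᵥ z * c
             map_add' := fun x y => by rw [mulVec_add, dotProduct_add, add_mul]
             map_smul' := fun a x => by
              simp only [mulVec_smul, dotProduct_smul, smul_eq_mul, mul_assoc, RingHom.id_apply] },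
      fun _ => rfl⟩

/-- The product of the values `v (2i) ⬝ Z v (2i+1)`, as a multilinear map in `v`. -/
noncomputable def pairingProduct {n : ℕ} (hn : Even n) (Z : Matrix (Fin n) (Fin n) ℝ) :
    MultilinearMap ℝ (fun _ : Fin n => Fin n → ℝ) ℝ :=
  MultilinearMap.mk' (fun v => ∏ i : Fin (n / 2),
      v ⟨2 * (i : ℕ), by have := i.isLt; omega⟩ ⬝ᵥ
        Z *ᵥ v ⟨2 * (i : ℕ) + 1, by have := i.isLt; omega⟩)
    (fun v j x y => by
      obtain ⟨φ, hφ⟩ := exists_linearMap_prod_dotProduct_update hn Z v j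
      simp only [hφ, map_add])
    (fun v j c x => by
      obtain ⟨φ, hφ⟩ := exists_linearMap_prod_dotProduct_update hn Z v j
      simp only [hφ, map_smul])

/-- The Pfaffian of `W Z Wᵀ` is a multiple of an alternating map evaluated at the rows of `W`. -/
theorem pfaffian_mul_mul_transpose_eq_alternatization {n : ℕ} (hn : Even n)
    (Z W : Matrix (Fin n) (Fin n) ℝ) :
    pfaffian (W * Z * Wᵀ) = ((2 : ℝ) ^ (n / 2) * (n / 2).factorial)⁻¹ *
      MultilinearMap.alternatization (pairingProduct hn Z) W.row := by
  rw [pfaffian, MultilinearMap.alternatization_apply]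
  congr 1
  refine Finset.sum_congr rfl fun σ _ => ?_
  rw [Units.smul_def, zsmul_eq_mul]
  congr 1
  refine Finset.prod_congr rfl fun i _ => ?_
  rw [Matrix.mul_assoc]
  rfl

/-- **Pfaffian under congruence:** for even `n`, skew-symmetric `Z` and any `W`,
`Pf (W Z Wᵀ) = Pf Z · det W`. -/
theorem stmt_8 (n : ℕ) (hn : Even n) (Z W : Matrix (Fin n) (Fin n) ℝ) (hZ : Zᵀ = -Z) :
    pfaffian (W * Z * Wᵀ) = pfaffian Z * W.det := by
  have h := pfaffian_mul_mul_transpose_eq_alternatization hn Z 1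
  rw [Matrix.one_mul, transpose_one, Matrix.mul_one] at h
  have hb : ⇑(Pi.basisFun ℝ (Fin n)) = (1 : Matrix (Fin n) (Fin n) ℝ).row := by
    ext i j
    simp [Matrix.one_apply, Pi.single_apply, eq_comm]
  have hW := congrArg (· W.row) (AlternatingMap.eq_smul_basis_det (Pi.basisFun ℝ (Fin n))
    (MultilinearMap.alternatization (pairingProduct hn Z)))
  rw [AlternatingMap.smul_apply, Pi.basisFun_det, hb, smul_eq_mul] at hW
  rw [pfaffian_mul_mul_transpose_eq_alternatization hn, h, hW, mul_assoc]
  rfl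
end

section
/- (Andréief's formula) Let (E, μ) be a measure space, N a natural number, and f_1, …, f_N, g_1, …, g_N : E → ℝ measurable functions such that f_i · g_j is μ-integrable for every i, j ∈ [N]. Then (1/N!) ∫_{E^N} det_{i,j ∈ [N]}( f_i(x_j) ) · det_{i,j ∈ [N]}( g_i(x_j) ) dμ(x_1)⋯dμ(x_N) = det_{i,j ∈ [N]} ( ∫_E f_i(x) g_j(x) dμ(x) ). -/
open MeasureTheory

/-- **Andréief's integration formula.**
`(1/N!) ∫ det(f_i(x_j)) det(g_i(x_j)) dμ^N = det (∫ f_i g_j dμ)`. -/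
theorem stmt_9 {E : Type*} [MeasurableSpace E] (μ : Measure E) [SigmaFinite μ] (N : ℕ)
    (f g : Fin N → E → ℝ)
    (hf : ∀ i, Measurable (f i)) (hg : ∀ i, Measurable (g i))
    (hint : ∀ i j, Integrable (fun x => f i x * g j x) μ) :
    ((N.factorial : ℝ))⁻¹ *
      ∫ x : Fin N → E,
        Matrix.det (Matrix.of fun i j : Fin N => f i (x j)) *
          Matrix.det (Matrix.of fun i j : Fin N => g i (x j))
        ∂(Measure.pi fun _ => μ)
      = Matrix.det (Matrix.of fun i j : Fin N => ∫ x, f i x * g j x ∂μ) := by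
  have hexp (x : Fin N → E) :
      Matrix.det (Matrix.of fun i j : Fin N => f i (x j)) *
          Matrix.det (Matrix.of fun i j : Fin N => g i (x j)) =
        ∑ τ : Equiv.Perm (Fin N), ∑ σ : Equiv.Perm (Fin N),
          ((Equiv.Perm.sign τ : ℤ) : ℝ) * (((Equiv.Perm.sign σ : ℤ) : ℝ) *
            ∏ j, f (σ j) (x j) * g (τ j) (x j)) := by
    rw [Matrix.det_apply', Matrix.det_apply', Finset.sum_mul_sum, Finset.sum_comm]
    refine Finset.sum_congr rfl fun τ _ => Finset.sum_congr rfl fun σ _ => ?_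
    simp only [Matrix.of_apply, Finset.prod_mul_distrib]
    ring
  have hprod (σ τ : Equiv.Perm (Fin N)) :
      Integrable (fun x : Fin N → E => ((Equiv.Perm.sign τ : ℤ) : ℝ) *
        (((Equiv.Perm.sign σ : ℤ) : ℝ) * ∏ j, f (σ j) (x j) * g (τ j) (x j)))
        (Measure.pi fun _ => μ) :=
    ((Integrable.fintype_prod (f := fun j y => f (σ j) y * g (τ j) y)
      fun j => hint (σ j) (τ j)).const_mul _).const_mul _
  set M : Matrix (Fin N) (Fin N) ℝ := Matrix.of fun i j => ∫ x, f i x * g j x ∂μ with hM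
  have hsum (τ : Equiv.Perm (Fin N)) :
      ∫ x : Fin N → E, ∑ σ : Equiv.Perm (Fin N), ((Equiv.Perm.sign τ : ℤ) : ℝ) *
        (((Equiv.Perm.sign σ : ℤ) : ℝ) * ∏ j, f (σ j) (x j) * g (τ j) (x j))
        ∂(Measure.pi fun _ => μ) = M.det := by
    have hsq : ((Equiv.Perm.sign τ : ℤ) : ℝ) * ((Equiv.Perm.sign τ : ℤ) : ℝ) = 1 := by
      rw [← Int.cast_mul, ← Units.val_mul, Int.units_mul_self]
      simp
    calc
      _ = ((Equiv.Perm.sign τ : ℤ) : ℝ) * (M.submatrix id τ).det := by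
        rw [integral_finsetSum _ fun σ _ => hprod σ τ, Matrix.det_apply', Finset.mul_sum]
        refine Finset.sum_congr rfl fun σ _ => ?_
        rw [integral_const_mul, integral_const_mul,
          integral_fintype_prod_eq_prod (f := fun j y => f (σ j) y * g (τ j) y)]
        rfl
      _ = M.det := by
        rw [Matrix.det_permute', ← mul_assoc, hsq, one_mul]
  simp_rw [hexp]
  rw [integral_finsetSum _ fun τ _ => integrable_finsetSum _ fun σ _ => hprod σ τ]
  simp_rw [hsum]
  rw [Finset.sum_const, Finset.card_univ, Fintype.card_perm, Fintype.card_fin, nsmul_eq_mul,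
    inv_mul_cancel_left₀ (Nat.cast_ne_zero.mpr N.factorial_ne_zero)]
end

section
/- (de Bruijn's formula, first form) Let (E, μ) be a measure space, n a natural number, f_1, …, f_{2n} : E → ℝ measurable, and A : E × E → ℝ a measurable skew-symmetric kernel (A(y,x) = −A(x,y)) such that (x,y) ↦ f_i(x) A(x,y) f_j(y) is integrable on E × E for all i, j. Then (1/(2n)!) ∫_{E^{2n}} det_{i,j ∈ [2n]}( f_j(x_i) ) · Pf_{i,j ∈ [2n]}( A(x_i, x_j) ) dμ(x_1)⋯dμ(x_{2n}) = Pf_{i,j ∈ [2n]} ( ∫∫ f_i(x) A(x,y) f_j(y) dμ(x) dμ(y) ). -/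
open MeasureTheory

/-- The point of `ι → E` obtained from a family of pairs of points, along a pairing
`e : κ × Fin 2 ≃ ι` of the index set. -/
def unpair {κ ι E : Type*} (e : κ × Fin 2 ≃ ι) (p : κ → E × E) (i : ι) : E :=
  if (e.symm i).2 = 0 then (p (e.symm i).1).1 else (p (e.symm i).1).2

section unpair

variable {κ ι E : Type*}

@[simp]
lemma unpair_zero (e : κ × Fin 2 ≃ ι) (p : κ → E × E) (k : κ) :
    unpair e p (e (k, 0)) = (p k).1 := by
  simp [unpair]

@[simp]
lemma unpair_one (e : κ × Fin 2 ≃ ι) (p : κ → E × E) (k : κ) :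
    unpair e p (e (k, 1)) = (p k).2 := by
  simp [unpair]

variable [Fintype κ] [Fintype ι]

lemma prod_eq_prod_pairs {M : Type*} [CommMonoid M] (e : κ × Fin 2 ≃ ι) (g : ι → M) :
    ∏ i, g i = ∏ k, g (e (k, 0)) * g (e (k, 1)) := by
  rw [← e.prod_comp, Fintype.prod_prod_type]
  simp [Fin.prod_univ_two]

variable {f : ι → E → ℝ} {A : E → E → ℝ}

lemma prod_mul_prod_kernel_unpair (e : κ × Fin 2 ≃ ι) (p : κ → E × E) :
    (∏ i, f i (unpair e p i)) * ∏ k, A (unpair e p (e (k, 0))) (unpair e p (e (k, 1))) =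
      ∏ k, f (e (k, 0)) (p k).1 * A (p k).1 (p k).2 * f (e (k, 1)) (p k).2 := by
  rw [prod_eq_prod_pairs e, ← Finset.prod_mul_distrib]
  refine Finset.prod_congr rfl fun k _ => ?_
  simp only [unpair_zero, unpair_one]
  ring

variable [MeasurableSpace E]

lemma measurePreserving_unpair (μ : Measure E) [SigmaFinite μ] (e : κ × Fin 2 ≃ ι) :
    MeasurePreserving (unpair e) (Measure.pi fun _ : κ => μ.prod μ)
      (Measure.pi fun _ : ι => μ) := by
  have hm : Measurable (unpair e : (κ → E × E) → ι → E) := by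
    refine measurable_pi_lambda _ fun i => ?_
    unfold unpair
    split_ifs <;> fun_prop
  refine ⟨hm, (Measure.pi_eq fun s hs => ?_).symm⟩
  rw [Measure.map_apply hm (MeasurableSet.univ_pi hs)]
  have hpre : unpair e ⁻¹' Set.univ.pi s =
      Set.univ.pi fun k => s (e (k, 0)) ×ˢ s (e (k, 1)) := by
    ext p
    simp only [Set.mem_preimage, Set.mem_univ_pi, Set.mem_prod]
    rw [← e.forall_congr_right (q := fun i => unpair e p i ∈ s i)]
    simp [Prod.forall, Fin.forall_fin_two]
  rw [hpre, Measure.pi_pi, prod_eq_prod_pairs e]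
  simp

variable {μ : Measure E} [SigmaFinite μ]

lemma measurable_prod_mul_prod_kernel (hf : ∀ i, Measurable (f i))
    (hA : Measurable (Function.uncurry A)) (e : κ × Fin 2 ≃ ι) :
    Measurable fun x : ι → E => (∏ i, f i (x i)) * ∏ k, A (x (e (k, 0))) (x (e (k, 1))) := by
  refine Measurable.mul (Finset.measurable_prod _ fun i _ => (hf i).comp (measurable_pi_apply i))
    (Finset.measurable_prod _ fun k _ => ?_)
  have h : Measurable fun x : ι → E => (x (e (k, 0)), x (e (k, 1))) := by fun_prop
  exact hA.comp h

lemma integrable_prod_mul_prod_kernel (hf : ∀ i, Measurable (f i))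
    (hA : Measurable (Function.uncurry A))
    (hint : ∀ i j, Integrable (fun p : E × E => f i p.1 * A p.1 p.2 * f j p.2) (μ.prod μ))
    (e : κ × Fin 2 ≃ ι) :
    Integrable (fun x : ι → E => (∏ i, f i (x i)) * ∏ k, A (x (e (k, 0))) (x (e (k, 1))))
      (Measure.pi fun _ => μ) := by
  rw [← (measurePreserving_unpair μ e).integrable_comp
    (measurable_prod_mul_prod_kernel hf hA e).aestronglyMeasurable]
  simp only [Function.comp_def, prod_mul_prod_kernel_unpair]
  exact Integrable.fintype_prod fun k => hint (e (k, 0)) (e (k, 1))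

lemma integral_prod_mul_prod_kernel (hf : ∀ i, Measurable (f i))
    (hA : Measurable (Function.uncurry A))
    (hint : ∀ i j, Integrable (fun p : E × E => f i p.1 * A p.1 p.2 * f j p.2) (μ.prod μ))
    (e : κ × Fin 2 ≃ ι) :
    ∫ x : ι → E, (∏ i, f i (x i)) * ∏ k, A (x (e (k, 0))) (x (e (k, 1)))
        ∂(Measure.pi fun _ => μ) =
      ∏ k, ∫ x, ∫ y, f (e (k, 0)) x * A x y * f (e (k, 1)) y ∂μ ∂μ := by
  rw [← (measurePreserving_unpair μ e).map_eq,
    integral_map (measurePreserving_unpair μ e).measurable.aemeasurable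
      (measurable_prod_mul_prod_kernel hf hA e).aestronglyMeasurable]
  simp only [prod_mul_prod_kernel_unpair]
  rw [integral_fintype_prod_eq_prod
    (f := fun k (q : E × E) => f (e (k, 0)) q.1 * A q.1 q.2 * f (e (k, 1)) q.2)]
  exact Finset.prod_congr rfl fun k _ => integral_prod _ (hint _ _)

end unpair

/-- The pairing of consecutive indices `2 * k`, `2 * k + 1`. -/
def consecutivePairs {m : ℕ} (hm : m / 2 * 2 = m) : Fin (m / 2) × Fin 2 ≃ Fin m :=
  finProdFinEquiv.trans (finCongr hm)

lemma pfaffian_eq_sum_pairs {m : ℕ} (hm : m / 2 * 2 = m) (M : Matrix (Fin m) (Fin m) ℝ) :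
    pfaffian M = ((2 : ℝ) ^ (m / 2) * (m / 2).factorial)⁻¹ *
      ∑ σ : Equiv.Perm (Fin m), ((Equiv.Perm.sign σ : ℤ) : ℝ) *
        ∏ k, M (σ (consecutivePairs hm (k, 0))) (σ (consecutivePairs hm (k, 1))) := by
  unfold pfaffian
  congr! 6 with σ _ k
  · simp [consecutivePairs, Fin.ext_iff]
  · simp [consecutivePairs, Fin.ext_iff, add_comm]

/-- **de Bruijn's integration formula (first form).**
`(1/(2n)!) ∫ det(f_j(x_i)) Pf(A(x_i,x_j)) dμ^{2n} = Pf (∫∫ f_i(x) A(x,y) f_j(y) dμ dμ)`. -/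
theorem stmt_10 {E : Type*} [MeasurableSpace E] (μ : Measure E) [SigmaFinite μ] (n : ℕ)
    (f : Fin (2 * n) → E → ℝ) (hf : ∀ i, Measurable (f i))
    (A : E → E → ℝ) (hA : Measurable (Function.uncurry A))
    (hskew : ∀ x y, A y x = -A x y)
    (hint : ∀ i j, Integrable (fun p : E × E => f i p.1 * A p.1 p.2 * f j p.2) (μ.prod μ)) :
    (((2 * n).factorial : ℝ))⁻¹ *
      ∫ x : Fin (2 * n) → E,
        Matrix.det (Matrix.of fun i j : Fin (2 * n) => f j (x i)) *
          pfaffian (Matrix.of fun i j : Fin (2 * n) => A (x i) (x j))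
        ∂(Measure.pi fun _ => μ)
      = pfaffian (Matrix.of fun i j : Fin (2 * n) =>
          ∫ x, ∫ y, f i x * A x y * f j y ∂μ ∂μ) := by
  have hm : 2 * n / 2 * 2 = 2 * n := by omega
  set e := consecutivePairs hm
  set F : Equiv.Perm (Fin (2 * n)) → Equiv.Perm (Fin (2 * n)) → (Fin (2 * n) → E) → ℝ :=
    fun τ σ x => (∏ i, f (τ i) (x i)) * ∏ k, A (x (σ (e (k, 0)))) (x (σ (e (k, 1)))) with hF
  set B : Equiv.Perm (Fin (2 * n)) → ℝ := fun ρ => ((Equiv.Perm.sign ρ : ℤ) : ℝ) *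
    ∏ k, ∫ x, ∫ y, f (ρ (e (k, 0))) x * A x y * f (ρ (e (k, 1))) y ∂μ ∂μ with hB
  set c : ℝ := ((2 : ℝ) ^ (2 * n / 2) * (2 * n / 2).factorial)⁻¹
  have hFint (τ σ) : Integrable (F τ σ) (Measure.pi fun _ => μ) :=
    integrable_prod_mul_prod_kernel (fun i => hf (τ i)) hA (fun i j => hint (τ i) (τ j))
      (e.trans σ)
  have hFeq (τ σ) : ((Equiv.Perm.sign τ : ℤ) : ℝ) * ((Equiv.Perm.sign σ : ℤ) : ℝ) *
      ∫ x, F τ σ x ∂(Measure.pi fun _ => μ) = B (τ * σ) := by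
    have h := integral_prod_mul_prod_kernel (fun i => hf (τ i)) hA
      (fun i j => hint (τ i) (τ j)) (e.trans σ)
    simp only [Equiv.trans_apply] at h
    simp only [hF, hB, h, Equiv.Perm.sign_mul, Equiv.Perm.mul_apply, Units.val_mul, Int.cast_mul]
  have hexp (x : Fin (2 * n) → E) :
      Matrix.det (Matrix.of fun i j : Fin (2 * n) => f j (x i)) *
          pfaffian (Matrix.of fun i j : Fin (2 * n) => A (x i) (x j)) =
        c * ∑ τ : Equiv.Perm (Fin (2 * n)), ∑ σ : Equiv.Perm (Fin (2 * n)),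
          ((Equiv.Perm.sign τ : ℤ) : ℝ) * ((Equiv.Perm.sign σ : ℤ) : ℝ) * F τ σ x := by
    rw [← Matrix.det_transpose, Matrix.det_apply', pfaffian_eq_sum_pairs hm, mul_left_comm,
      Finset.sum_mul_sum]
    congr! 3 with τ _ σ _
    simp only [hF, Matrix.transpose_apply, Matrix.of_apply]
    ring
  have hsum : ∫ x : Fin (2 * n) → E, ∑ τ : Equiv.Perm (Fin (2 * n)),
      ∑ σ : Equiv.Perm (Fin (2 * n)),
        ((Equiv.Perm.sign τ : ℤ) : ℝ) * ((Equiv.Perm.sign σ : ℤ) : ℝ) * F τ σ x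
        ∂(Measure.pi fun _ => μ) = (2 * n).factorial * ∑ ρ, B ρ := by
    rw [integral_finsetSum _ fun τ _ => integrable_finsetSum _ fun σ _ =>
      (hFint τ σ).const_mul _]
    have hτ (τ : Equiv.Perm (Fin (2 * n))) : ∫ x : Fin (2 * n) → E,
        ∑ σ : Equiv.Perm (Fin (2 * n)),
          ((Equiv.Perm.sign τ : ℤ) : ℝ) * ((Equiv.Perm.sign σ : ℤ) : ℝ) * F τ σ x
          ∂(Measure.pi fun _ => μ) = ∑ ρ, B ρ := by
      rw [integral_finsetSum _ fun σ _ => (hFint τ σ).const_mul _]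
      simp only [integral_const_mul, hFeq]
      exact Equiv.sum_comp (Equiv.mulLeft τ) B
    simp [hτ, Fintype.card_perm]
  simp only [hexp, integral_const_mul, hsum]
  rw [pfaffian_eq_sum_pairs hm, mul_left_comm, inv_mul_cancel_left₀ (by positivity)]
  rfl
end
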